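/- Let p be a polynomial of degree d ≥ 2 with connected Julia set, and let f be a Poincaré function of p at a repelling fixed point. If area K(p) > 0, then area I(f) = 0. -/

import Mathlib

open MeasureTheory Filter Metric Set Topology ENNReal

/-- Logarithmic area of a subset of the plane. -/
noncomputable def logArea (A : Set ℂ) : ℝ≥0∞ :=
  ∫⁻ z in A, ENNReal.ofReal ((‖z‖ ^ 2)⁻¹)

/-- The set Δ = {z : |z| ≥ 1}. -/
def Delta : Set ℂ := {z : ℂ | 1 ≤ ‖z‖}

/-- Chordal (spherical) distance on the Riemann sphere ℂ ∪ {∞}, with ∞ encoded as `none`. -/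
noncomputable def chordalDist : Option ℂ → Option ℂ → ℝ
  | none, none => 0
  | none, some w => 2 / Real.sqrt (1 + ‖w‖ ^ 2)
  | some z, none => 2 / Real.sqrt (1 + ‖z‖ ^ 2)
  | some z, some w =>
      2 * ‖z - w‖ / (Real.sqrt (1 + ‖z‖ ^ 2) * Real.sqrt (1 + ‖w‖ ^ 2))

/-- Locally uniform convergence on `U` of a sequence of ℂ-valued functions towards a
function with values in the Riemann sphere, with respect to the spherical metric. -/
def SphLocUnifConvOn (F : ℕ → ℂ → ℂ) (g : ℂ → Option ℂ) (U : Set ℂ) : Prop :=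
  ∀ K : Set ℂ, K ⊆ U → IsCompact K → ∀ ε : ℝ, 0 < ε →
    ∀ᶠ n in atTop, ∀ z ∈ K, chordalDist (some (F n z)) (g z) < ε

/-- The Fatou set: points having a neighborhood on which every sequence of iterates has a
subsequence converging locally uniformly with respect to the spherical metric. -/
def fatouSet (f : ℂ → ℂ) : Set ℂ :=
  {z | ∃ U ∈ 𝓝 z, ∀ φ : ℕ → ℕ, StrictMono φ →
    ∃ ψ : ℕ → ℕ, StrictMono ψ ∧ ∃ g : ℂ → Option ℂ,
      SphLocUnifConvOn (fun n => f^[φ (ψ n)]) g U}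

/-- The Julia set. -/
def juliaSet (f : ℂ → ℂ) : Set ℂ := (fatouSet f)ᶜ

/-- The escaping set. -/
def escapingSet (f : ℂ → ℂ) : Set ℂ :=
  {z | Tendsto (fun n => ‖f^[n] z‖) atTop atTop}

/-- The Fatou set has no multiply connected component. -/
def NoMultiplyConnectedFatouComponent (f : ℂ → ℂ) : Prop :=
  ∀ z ∈ fatouSet f, SimplyConnectedSpace (connectedComponentIn (fatouSet f) z)

/-- Maximum modulus M(r,f). -/
noncomputable def maxMod (f : ℂ → ℂ) (r : ℝ) : ℝ :=
  sSup ((fun z => ‖f z‖) '' {z : ℂ | ‖z‖ = r})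

/-- The order ρ(f) of an entire function, as an extended real number. -/
noncomputable def entireOrder (f : ℂ → ℂ) : EReal :=
  limsup (fun r : ℝ => ((Real.log (Real.log (maxMod f r)) / Real.log r : ℝ) : EReal)) atTop

/-- The fast escaping set A(f). -/
def fastEscapingSet (f : ℂ → ℂ) : Set ℂ :=
  {z | ∃ R : ℝ, 0 < R ∧ (∀ r : ℝ, R ≤ r → r < maxMod f r) ∧
    ∃ L : ℕ, ∀ n : ℕ, L < n → (maxMod f)^[n - L] R ≤ ‖f^[n] z‖}

/-- `f` is a transcendental entire function. -/
def TranscendentalEntire (f : ℂ → ℂ) : Prop :=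
  Differentiable ℂ f ∧ ¬ ∃ p : Polynomial ℂ, ∀ z, f z = p.eval z

/-- Order of vanishing of `g` at `z` (the least `k` with nonzero `k`-th derivative). -/
noncomputable def vanishingOrder (g : ℂ → ℂ) (z : ℂ) : ℕ :=
  sInf {k : ℕ | iteratedDeriv k g z ≠ 0}

/-- n(r,a): the number of solutions of f(z) = a with |z| ≤ r, counted with multiplicity. -/
noncomputable def nCount (f : ℂ → ℂ) (a : ℂ) (r : ℝ) : ℕ :=
  ∑ᶠ z ∈ {z : ℂ | ‖z‖ ≤ r ∧ f z = a}, vanishingOrder (fun w => f w - a) z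

/-- n(r) = max over a of n(r,a). -/
noncomputable def nMax (f : ℂ → ℂ) (r : ℝ) : ℕ := ⨆ a : ℂ, nCount f a r

/-- Critical values of `f`. -/
def criticalValues (f : ℂ → ℂ) : Set ℂ := {w | ∃ z, deriv f z = 0 ∧ f z = w}

/-- Finite asymptotic values of `f`. -/
def asymptoticValues (f : ℂ → ℂ) : Set ℂ :=
  {w | ∃ γ : ℝ → ℂ, Continuous γ ∧ Tendsto (fun t => ‖γ t‖) atTop atTop ∧
    Tendsto (fun t => f (γ t)) atTop (𝓝 w)}

/-- The Eremenko–Lyubich class B. -/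
def ELClass (f : ℂ → ℂ) : Prop :=
  TranscendentalEntire f ∧ Bornology.IsBounded (criticalValues f ∪ asymptoticValues f)

/-- Semihyperbolic polynomial. -/
def SemiHyperbolic (p : Polynomial ℂ) : Prop :=
  ∃ ε : ℝ, 0 < ε ∧ ∃ N : ℕ, ∀ z ∈ juliaSet (fun w => p.eval w), ∀ n : ℕ, 1 ≤ n →
    ∀ V : Set ℂ, (∃ u ∈ (fun w => p.eval w)^[n] ⁻¹' ball z ε,
        V = connectedComponentIn ((fun w => p.eval w)^[n] ⁻¹' ball z ε) u) →
      ∀ w ∈ ball z ε,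
        (∑ᶠ u ∈ {u : ℂ | u ∈ V ∧ (fun v => p.eval v)^[n] u = w},
          vanishingOrder (fun ζ => (fun v => p.eval v)^[n] ζ - w) u) ≤ N

/-- A nonvanishing holomorphic function on a convex open set where holomorphic functions have
primitives has a holomorphic logarithm. -/
theorem exists_log_of_exact {g : ℂ → ℂ} {S : Set ℂ} (hS : IsOpen S) (hconv : Convex ℝ S)
    (hex : ∀ d : ℂ → ℂ, DifferentiableOn ℂ d S → Complex.IsExactOn d S)
    (hg : DifferentiableOn ℂ g S) (h0 : ∀ z ∈ S, g z ≠ 0) :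
    ∃ L : ℂ → ℂ, DifferentiableOn ℂ L S ∧ ∀ z ∈ S, Complex.exp (L z) = g z := by
  rcases S.eq_empty_or_nonempty with rfl | ⟨c, hc⟩
  · exact ⟨0, by simp, by simp⟩
  have hd : DifferentiableOn ℂ (fun z => deriv g z / g z) S := (hg.deriv hS).div hg h0
  obtain ⟨L, hLc, hL⟩ := (hex _ hd).with_val_at c (Complex.log (g c))
  refine ⟨L, fun z hz => (hL z hz).differentiableAt.differentiableWithinAt, fun z hz => ?_⟩
  have hD : ∀ x ∈ S, HasDerivAt (fun z => Complex.exp (-(L z)) * g z) 0 x := by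
    intro x hx
    have h1 := (hL x hx).neg.cexp.mul (hg.differentiableAt (hS.mem_nhds hx)).hasDerivAt
    refine h1.congr_deriv ?_
    have := h0 x hx
    have h2 : deriv g x / g x * g x = deriv g x := by field_simp
    linear_combination -Complex.exp (-L x) * h2
  have := hS.is_const_of_deriv_eq_zero hconv.isPreconnected
    (fun x hx => (hD x hx).differentiableAt.differentiableWithinAt)
    (fun x hx => (hD x hx).deriv) hz hc
  simp only [hLc, Complex.exp_neg, Complex.exp_log (h0 c hc)] at this
  rw [inv_mul_cancel₀ (h0 c hc)] at this
  field_simp [Complex.exp_ne_zero] at this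
  exact this.symm

/-- A nonvanishing holomorphic function on a disc has a holomorphic logarithm. -/
theorem exists_log_on_ball {g : ℂ → ℂ} {c : ℂ} {r : ℝ} (hg : DifferentiableOn ℂ g (ball c r))
    (h0 : ∀ z ∈ ball c r, g z ≠ 0) :
    ∃ L : ℂ → ℂ, DifferentiableOn ℂ L (ball c r) ∧ ∀ z ∈ ball c r, Complex.exp (L z) = g z :=
  exists_log_of_exact isOpen_ball (convex_ball c r) (fun _ hd => hd.isExactOn_ball) hg h0

/-- A nonvanishing entire function has an entire logarithm. -/
theorem exists_log_of_entire {g : ℂ → ℂ} (hg : Differentiable ℂ g) (h0 : ∀ z, g z ≠ 0) :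
    ∃ L : ℂ → ℂ, Differentiable ℂ L ∧ ∀ z, Complex.exp (L z) = g z := by
  obtain ⟨L, hL, hLg⟩ := exists_log_of_exact isOpen_univ convex_univ
    (fun _ hd => (differentiableOn_univ.1 hd).isExactOn_univ) hg.differentiableOn
    (fun z _ => h0 z)
  exact ⟨L, differentiableOn_univ.1 hL, fun z => hLg z (mem_univ z)⟩

/-- Inverse function of an injective holomorphic function with nonvanishing derivative. -/
theorem exists_inverse_of_injOn {g : ℂ → ℂ} {O : Set ℂ} (hO : IsOpen O)
    (hg : DifferentiableOn ℂ g O) (hi : InjOn g O) (h0 : ∀ z ∈ O, deriv g z ≠ 0) :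
    ∃ k : ℂ → ℂ, (∀ z ∈ O, k (g z) = z) ∧ ∀ z ∈ O, HasDerivAt k (deriv g z)⁻¹ (g z) := by
  refine ⟨Function.invFunOn g O, fun z hz => hi.leftInvOn_invFunOn hz, fun z hz => ?_⟩
  set k := Function.invFunOn g O
  have hk : ∀ z ∈ O, k (g z) = z := fun z hz => hi.leftInvOn_invFunOn hz
  have hs : HasStrictDerivAt g (deriv g z) z :=
    (hg.analyticAt (hO.mem_nhds hz)).hasStrictDerivAt
  have hmap := hs.map_nhds_eq (h0 z hz)
  have hc : ContinuousAt k (g z) := by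
    rw [ContinuousAt, hk z hz, ← hmap, tendsto_map'_iff]
    refine tendsto_id.congr' ?_
    filter_upwards [hO.mem_nhds hz] with x hx
    simp [hk x hx]
  refine HasDerivAt.of_local_left_inverse hc (by rw [hk z hz]; exact hs.hasDerivAt) (h0 z hz) ?_
  rw [← hmap, eventually_map]
  filter_upwards [hO.mem_nhds hz] with x hx
  rw [hk x hx]

/-- A weak form of Bloch's theorem, for a function whose image contains no disc of radius `D`. -/
theorem norm_deriv_mul_radius_le_of_omits {h : ℂ → ℂ} {c : ℂ} {r D : ℝ} (hr : 0 < r) (hD : 0 ≤ D)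
    (hh : DifferentiableOn ℂ h (ball c r))
    (hom : ∀ y : ℂ, ∃ x ∈ ball y D, x ∉ h '' ball c r) :
    ‖deriv h c‖ * r ≤ 128 * D := by
  rcases eq_or_ne (deriv h c) 0 with hz | hz
  · rw [hz]; simp; positivity
  have hm : 0 < ‖deriv h c‖ := norm_pos_iff.2 hz
  have hsub : closedBall c (r / 2) ⊆ ball c r := closedBall_subset_ball (by linarith)
  have hcont : ContinuousOn (fun z => ‖deriv h z‖ * (r / 2 - ‖z - c‖)) (closedBall c (r / 2)) := by
    refine ContinuousOn.mul ((hh.deriv isOpen_ball).continuousOn.mono hsub).norm ?_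
    fun_prop
  obtain ⟨a, ha, hmax⟩ := (isCompact_closedBall c (r / 2)).exists_isMaxOn
    ⟨c, mem_closedBall_self (by linarith)⟩ hcont
  have h1 : ‖deriv h c‖ * (r / 2) ≤ ‖deriv h a‖ * (r / 2 - ‖a - c‖) := by
    have := hmax (mem_closedBall_self (by linarith) : c ∈ closedBall c (r / 2))
    simpa using this
  set M := ‖deriv h a‖ with hM
  set s := (r / 2 - ‖a - c‖) / 2 with hs
  have hpos : 0 < M * (r / 2 - ‖a - c‖) := lt_of_lt_of_le (by positivity) h1
  have hM0 : 0 < M := by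
    rcases (norm_nonneg (deriv h a)).eq_or_lt with h | h
    · rw [hM, ← h] at hpos; simp at hpos
    · exact h
  have hs0 : 0 < s := by
    have := (mul_pos_iff_of_pos_left hM0).1 hpos
    linarith
  have hsb : ball a s ⊆ closedBall c (r / 2) := by
    intro z hz
    rw [mem_ball, dist_eq_norm] at hz
    rw [mem_closedBall, dist_eq_norm]
    have : z - c = (z - a) + (a - c) := by ring
    rw [this]
    refine (norm_add_le _ _).trans ?_
    linarith
  have h2 : ∀ z ∈ ball a s, ‖deriv h z‖ ≤ 2 * M := by
    intro z hz
    have h3 := hmax (hsb hz)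
    simp only [mem_ofPred_eq] at h3
    rw [mem_ball, dist_eq_norm] at hz
    have h4 : s ≤ r / 2 - ‖z - c‖ := by
      have := norm_add_le (z - a) (a - c)
      rw [show (z - a) + (a - c) = z - c by ring] at this
      linarith
    have h5 : ‖deriv h z‖ * s ≤ M * (2 * s) := by
      calc _ ≤ ‖deriv h z‖ * (r / 2 - ‖z - c‖) := by gcongr
        _ ≤ _ := h3
        _ = M * (2 * s) := by rw [hs]; ring
    nlinarith
  have hdb : DifferentiableOn ℂ (deriv h) (ball a s) :=
    (hh.deriv isOpen_ball).mono (hsb.trans hsub)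
  have hmaps : MapsTo (deriv h) (ball a s) (closedBall (deriv h a) (4 * M)) := by
    intro z hz
    rw [mem_closedBall, dist_eq_norm]
    have := norm_sub_le (deriv h z) (deriv h a)
    have := h2 z hz
    linarith
  have hschw : ∀ z ∈ ball a s, ‖deriv h z - deriv h a‖ ≤ 4 * M / s * ‖z - a‖ := by
    intro z hz
    have := Complex.dist_le_div_mul_dist_of_mapsTo_ball hdb hmaps hz
    rwa [dist_eq_norm, dist_eq_norm] at this
  have ht8 : closedBall a (s / 8) ⊆ ball a s := closedBall_subset_ball (by linarith)
  have hlin : ∀ z ∈ closedBall a (s / 8), ‖(h z - deriv h a * z) - (h a - deriv h a * a)‖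
      ≤ M / 2 * ‖z - a‖ := by
    intro z hz
    have hdiff : ∀ x ∈ closedBall a (s / 8), HasDerivAt (fun z => h z - deriv h a * z)
        (deriv h x - deriv h a) x := by
      intro x hx
      have := (hh.differentiableAt (isOpen_ball.mem_nhds (hsub (hsb (ht8 hx))))).hasDerivAt
      exact this.sub (by simpa using (hasDerivAt_id x).const_mul (deriv h a))
    refine Convex.norm_image_sub_le_of_norm_deriv_le (fun x hx => (hdiff x hx).differentiableAt)
      (fun x hx => ?_) (convex_closedBall a (s / 8)) (mem_closedBall_self (by linarith)) hz
    rw [(hdiff x hx).deriv]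
    refine (hschw x (ht8 hx)).trans ?_
    rw [mem_closedBall, dist_eq_norm] at hx
    calc _ ≤ 4 * M / s * (s / 8) := by gcongr
      _ = M / 2 := by field_simp; norm_num
  have hsph : ∀ z ∈ sphere a (s / 8), M * s / 16 ≤ ‖h z - h a‖ := by
    intro z hz
    have h6 := hlin z (sphere_subset_closedBall hz)
    rw [mem_sphere, dist_eq_norm] at hz
    have h7 : deriv h a * (z - a) = (h z - h a) -
      ((h z - deriv h a * z) - (h a - deriv h a * a)) := by ring
    have h8 := norm_sub_le (h z - h a) ((h z - deriv h a * z) - (h a - deriv h a * a))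
    rw [← h7, norm_mul, hz] at h8
    rw [hz] at h6
    linarith
  have hfreq : ∃ᶠ z in 𝓝 a, h z ≠ h a := by
    intro hne
    have : h =ᶠ[𝓝 a] fun _ => h a := by
      filter_upwards [hne] with x hx
      simpa using hx
    have := this.deriv_eq
    simp only [deriv_const] at this
    rw [hM, this] at hM0
    simp at hM0
  have himg := DiffContOnCl.ball_subset_image_closedBall (f := h) (z₀ := a) (r := s / 8)
    (ε := M * s / 16)
    ((hh.mono (ht8.trans (hsb.trans hsub))).diffContOnCl_ball subset_rfl) (by linarith) hsph hfreq
  obtain ⟨x, hx, hxn⟩ := hom (h a)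
  by_contra! hcon
  apply hxn
  have hx' : x ∈ ball (h a) (M * s / 16 / 2) := by
    refine ball_subset_ball ?_ hx
    have : M * (r / 2 - ‖a - c‖) = M * s * 2 := by rw [hs]; ring
    linarith
  obtain ⟨y, hy, rfl⟩ := himg hx'
  exact ⟨y, hsub (hsb (ht8 hy)), rfl⟩

/-- A weak form of Bieberbach's coefficient estimate for univalent functions. -/
theorem exists_second_deriv_bound : ∃ C : ℝ, 0 < C ∧ ∀ (g : ℂ → ℂ) (c : ℂ) (r : ℝ), 0 < r →
    DifferentiableOn ℂ g (ball c r) → InjOn g (ball c r) → (∀ z ∈ ball c r, deriv g z ≠ 0) →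
    ‖deriv (deriv g) c‖ * r ≤ C * ‖deriv g c‖ := by
  refine ⟨14336 * Real.exp 896, by positivity, fun g c r hr hg hi h0 => ?_⟩
  have hc : c ∈ ball c r := mem_ball_self hr
  set m := ‖deriv g c‖ with hm
  have hm0 : 0 < m := norm_pos_iff.2 (h0 c hc)
  obtain ⟨k, hk, hk'⟩ := exists_inverse_of_injOn isOpen_ball hg hi h0
  have hom : ∃ a ∈ ball (g c) (2 * m * r), a ∉ g '' ball c r := by
    by_contra! hcon
    have hkd : DifferentiableOn ℂ k (ball (g c) (2 * m * r)) := by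
      intro y hy
      obtain ⟨x, hx, rfl⟩ := hcon y hy
      exact (hk' x hx).differentiableAt.differentiableWithinAt
    have hkm : MapsTo k (ball (g c) (2 * m * r)) (closedBall (k (g c)) r) := by
      intro y hy
      obtain ⟨x, hx, rfl⟩ := hcon y hy
      rw [hk x hx, hk c hc]
      exact ball_subset_closedBall hx
    have := Complex.norm_deriv_le_div_of_mapsTo_ball hkd hkm (by positivity)
    rw [(hk' c hc).deriv, norm_inv, ← hm] at this
    have h2 : r / (2 * m * r) = m⁻¹ / 2 := by field_simp
    rw [h2] at this
    have : 0 < m⁻¹ := by positivity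
    linarith
  obtain ⟨a, ha, hna⟩ := hom
  have hne : ∀ z ∈ ball c r, g z - a ≠ 0 := fun z hz h => hna ⟨z, hz, sub_eq_zero.1 h⟩
  obtain ⟨L, hL, hLg⟩ := exists_log_on_ball (hg.sub_const a) hne
  have hLom : ∀ y : ℂ, ∃ x ∈ ball y 7, x ∉ L '' ball c r := by
    intro y
    by_contra! hcon
    obtain ⟨x₁, hx₁, e₁⟩ := hcon y (mem_ball_self (by norm_num))
    obtain ⟨x₂, hx₂, e₂⟩ := hcon (y + 2 * Real.pi * Complex.I) (by
      rw [mem_ball, dist_eq_norm]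
      have : ‖y + 2 * Real.pi * Complex.I - y‖ = 2 * Real.pi := by
        simp [abs_of_pos Real.pi_pos]
      rw [this]
      linarith [Real.pi_lt_d2])
    have h1 := hLg x₁ hx₁
    have h2 := hLg x₂ hx₂
    rw [e₁] at h1
    rw [e₂, Complex.exp_periodic y, h1] at h2
    have h3 : x₁ = x₂ := hi hx₁ hx₂ (sub_left_injective h2)
    rw [← h3, e₁] at e₂
    have : (2 * Real.pi * Complex.I : ℂ) = 0 := by linear_combination -e₂
    simp [Real.pi_ne_zero] at this
  have hL' : ∀ x ∈ ball c (r / 2), ‖deriv L x‖ ≤ 1792 / r := by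
    intro x hx
    have hsub : ball x (r / 2) ⊆ ball c r := by
      apply ball_subset_ball'
      rw [mem_ball] at hx
      linarith
    have := norm_deriv_mul_radius_le_of_omits (c := x) (r := r / 2) (D := 7) (by positivity)
      (by norm_num) (hL.mono hsub) (fun y => by
        obtain ⟨w, hw, hwn⟩ := hLom y
        exact ⟨w, hw, fun h => hwn (image_mono hsub h)⟩)
    rw [le_div_iff₀ hr]
    linarith
  have hsub2 : ball c (r / 2) ⊆ ball c r := ball_subset_ball (by linarith)
  have hLb : ∀ x ∈ ball c (r / 2), ‖L x - L c‖ ≤ 896 := by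
    intro x hx
    have := Convex.norm_image_sub_le_of_norm_deriv_le
      (fun x hx => hL.differentiableAt (isOpen_ball.mem_nhds (hsub2 hx))) hL' (convex_ball c (r / 2))
      (mem_ball_self (by positivity)) hx
    rw [mem_ball, dist_eq_norm] at hx
    refine this.trans ?_
    calc _ ≤ 1792 / r * (r / 2) := by gcongr
      _ = 896 := by field_simp; norm_num
  have hg' : ∀ x ∈ ball c (r / 2), ‖deriv g x‖ ≤ 3584 * Real.exp 896 * m := by
    intro x hx
    have hxr := isOpen_ball.mem_nhds (hsub2 hx)
    have h1 : deriv g x = Complex.exp (L x) * deriv L x := by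
      have h2 : (fun z => Complex.exp (L z)) =ᶠ[𝓝 x] fun z => g z - a := by
        filter_upwards [hxr] with z hz using hLg z hz
      have h3 := (hL.differentiableAt hxr).hasDerivAt.cexp
      have h4 := h2.deriv_eq
      rw [h3.deriv, deriv_sub_const] at h4
      exact h4.symm
    have h5 : Complex.exp (L x) = (g c - a) * Complex.exp (L x - L c) := by
      rw [← hLg c hc, ← Complex.exp_add]; ring_nf
    rw [h1, h5, norm_mul, norm_mul]
    have h6 : ‖g c - a‖ ≤ 2 * m * r := by
      rw [mem_ball, dist_comm, dist_eq_norm] at ha; exact ha.le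
    have h7 : ‖Complex.exp (L x - L c)‖ ≤ Real.exp 896 := by
      rw [Complex.norm_exp]
      exact Real.exp_le_exp.2 ((Complex.re_le_norm _).trans (hLb x hx))
    calc _ ≤ 2 * m * r * Real.exp 896 * (1792 / r) := by gcongr; exact hL' x hx
      _ = _ := by field_simp; norm_num
  have hsub4 : closedBall c (r / 4) ⊆ ball c (r / 2) := closedBall_subset_ball (by linarith)
  have := Complex.norm_deriv_le_of_forall_mem_sphere_norm_le (c := c) (R := r / 4)
    (f := deriv g) (C := 3584 * Real.exp 896 * m) (by positivity)
    (((hg.deriv isOpen_ball).mono (hsub4.trans hsub2)).diffContOnCl_ball subset_rfl)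
    (fun z hz => hg' z (hsub4 (sphere_subset_closedBall hz)))
  rw [le_div_iff₀ (by positivity)] at this
  linarith

theorem exists_mem_ball_cosh_sq_eq_int (y : ℂ) :
    ∃ x ∈ ball y 7, ∃ n : ℤ, Complex.cosh x ^ 2 = n := by
  have key : ∀ t : ℝ, 0 ≤ t → ∃ u : ℝ, |u - t| ≤ 1 ∧ ∃ n : ℤ, Real.cosh u ^ 2 = n := by
    intro t ht
    have h1 : Real.cosh t ^ 2 + 1 ≤ Real.cosh (t + 1) ^ 2 := by
      have hs : 1 ≤ Real.sinh 1 := Real.self_le_sinh_iff.2 (by norm_num)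
      have hst : 0 ≤ Real.sinh t := Real.sinh_nonneg_iff.2 ht
      have hc1 := Real.cosh_sq 1
      have hct := Real.one_le_cosh t
      have h2 : Real.cosh t * Real.cosh 1 ≤ Real.cosh (t + 1) := by
        rw [Real.cosh_add]; nlinarith
      have h3 := pow_le_pow_left₀ (by positivity) h2 2
      have h4 : 1 ≤ Real.cosh t ^ 2 := one_le_pow₀ hct
      have h5 : 1 ≤ Real.sinh 1 ^ 2 := one_le_pow₀ hs
      rw [mul_pow, hc1] at h3
      nlinarith
    have hcont : ContinuousOn (fun u => Real.cosh u ^ 2) (Icc t (t + 1)) := by fun_prop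
    obtain ⟨u, hu, hun⟩ := intermediate_value_Icc (by linarith) hcont
      (show ((⌈Real.cosh t ^ 2⌉ : ℤ) : ℝ) ∈ _ from
        ⟨Int.le_ceil _, (Int.ceil_lt_add_one _).le.trans h1⟩)
    exact ⟨u, by rw [abs_le]; constructor <;> linarith [hu.1, hu.2], _, hun⟩
  obtain ⟨u, hu, n, hn⟩ : ∃ u : ℝ, |u - y.re| ≤ 1 ∧ ∃ n : ℤ, Real.cosh u ^ 2 = n := by
    rcases le_total 0 y.re with h | h
    · exact key _ h
    · obtain ⟨u, hu, n, hn⟩ := key (-y.re) (by linarith)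
      refine ⟨-u, ?_, n, by rw [Real.cosh_neg, hn]⟩
      rw [abs_sub_comm]
      convert hu using 2
      ring
  set m : ℤ := round (y.im / Real.pi) with hm
  refine ⟨u + m * (Real.pi * Complex.I), ?_, n, ?_⟩
  · rw [mem_ball, dist_eq_norm]
    refine (Complex.norm_le_abs_re_add_abs_im _).trans_lt ?_
    have h1 : ((u : ℂ) + m * (Real.pi * Complex.I) - y).re = u - y.re := by simp
    have h2 : ((u : ℂ) + m * (Real.pi * Complex.I) - y).im = m * Real.pi - y.im := by simp
    rw [h1, h2]
    have h3 := abs_sub_round (y.im / Real.pi)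
    have h4 : |m * Real.pi - y.im| = |y.im / Real.pi - m| * Real.pi := by
      rw [abs_sub_comm]
      nth_rewrite 3 [← abs_of_pos Real.pi_pos]
      rw [← abs_mul]
      congr 1
      field_simp [Real.pi_ne_zero]
    rw [h4]
    have h5 : |y.im / Real.pi - m| * Real.pi ≤ 1 / 2 * Real.pi := by gcongr
    linarith [Real.pi_lt_d2]
  · have h1 : ∀ z : ℂ, Complex.cosh z ^ 2 = (Complex.exp (2 * z) + (Complex.exp (2 * z))⁻¹ + 2) / 4 := by
      intro z
      have he := Complex.exp_ne_zero z
      rw [Complex.cosh, Complex.exp_neg, two_mul, Complex.exp_add]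
      field_simp
      ring
    have h2 : Complex.exp (2 * (u + m * (Real.pi * Complex.I))) = Complex.exp (2 * u) := by
      have := (Complex.exp_periodic.int_mul m) (2 * (u : ℂ))
      rw [← this]; ring_nf
    rw [h1, h2, ← h1]
    exact_mod_cast hn

theorem deriv_eq_zero_of_omits_zero_one {f : ℂ → ℂ} (hf : Differentiable ℂ f)
    (h0 : ∀ z, f z ≠ 0) (h1 : ∀ z, f z ≠ 1) (c : ℂ) : deriv f c = 0 := by
  obtain ⟨L, hL, hLf⟩ := exists_log_of_entire hf h0
  have hpi : (2 * Real.pi * Complex.I : ℂ) ≠ 0 := by simp [Real.pi_ne_zero]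
  set N : ℂ → ℂ := fun z => L z / (2 * Real.pi * Complex.I) with hN
  have hNd : Differentiable ℂ N := hL.div_const _
  have hfN : ∀ z, f z = Complex.exp (N z * (2 * Real.pi * Complex.I)) := by
    intro z
    rw [hN, ← hLf z]; field_simp
  have hNn : ∀ z, ∀ n : ℤ, N z ≠ n := by
    intro z n h
    apply h1 z
    rw [hfN, h, Complex.exp_int_mul_two_pi_mul_I]
  obtain ⟨l₁, hl₁, e₁⟩ := exists_log_of_entire hNd (fun z => by simpa using hNn z 0)
  obtain ⟨l₂, hl₂, e₂⟩ := exists_log_of_entire (hNd.sub_const 1)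
    (fun z h => hNn z 1 (by simpa using sub_eq_zero.1 h))
  set s₁ : ℂ → ℂ := fun z => Complex.exp (l₁ z / 2)
  set s₂ : ℂ → ℂ := fun z => Complex.exp (l₂ z / 2)
  have hs₁ : ∀ z, s₁ z ^ 2 = N z := by
    intro z; rw [← e₁, ← Complex.exp_nat_mul]; congr 1; push_cast; ring
  have hs₂ : ∀ z, s₂ z ^ 2 = N z - 1 := by
    intro z; rw [← e₂, ← Complex.exp_nat_mul]; congr 1; push_cast; ring
  have hprod : ∀ z, (s₁ z - s₂ z) * (s₁ z + s₂ z) = 1 := by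
    intro z; linear_combination hs₁ z - hs₂ z
  obtain ⟨h, hh, eh⟩ := exists_log_of_entire (g := fun z => s₁ z - s₂ z)
    ((hl₁.div_const 2).cexp.sub (hl₂.div_const 2).cexp) (fun z => left_ne_zero_of_mul_eq_one (hprod z))
  have hcosh : ∀ z, N z = Complex.cosh (h z) ^ 2 := by
    intro z
    rw [Complex.cosh, Complex.exp_neg, eh, inv_eq_of_mul_eq_one_right (hprod z),
      ← hs₁]
    ring
  have hh' : deriv h c = 0 := by
    rw [← norm_eq_zero]
    by_contra hne
    have hpos : 0 < ‖deriv h c‖ := lt_of_le_of_ne (norm_nonneg _) (Ne.symm hne)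
    have := norm_deriv_mul_radius_le_of_omits (h := h) (c := c) (r := 897 / ‖deriv h c‖) (D := 7)
      (by positivity) (by norm_num) hh.differentiableOn (fun y => by
        obtain ⟨x, hx, n, hn⟩ := exists_mem_ball_cosh_sq_eq_int y
        refine ⟨x, hx, ?_⟩
        rintro ⟨w, -, rfl⟩
        exact hNn w n (by rw [hcosh, hn]))
    rw [mul_div_cancel₀ _ hne] at this
    norm_num at this
  have hfun : f = fun z => Complex.exp (Complex.cosh (h z) ^ 2 * (2 * Real.pi * Complex.I)) := by
    funext z; rw [hfN, hcosh]
  have hd : HasDerivAt h 0 c := hh' ▸ (hh c).hasDerivAt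
  rw [hfun]
  have := (((hd.ccosh).pow 2).mul_const (2 * Real.pi * Complex.I : ℂ)).cexp.deriv
  simpa using this

/-- **Little Picard theorem**. -/
theorem deriv_eq_zero_of_omits {f : ℂ → ℂ} (hf : Differentiable ℂ f) {a b : ℂ} (hab : a ≠ b)
    (ha : ∀ z, f z ≠ a) (hb : ∀ z, f z ≠ b) (c : ℂ) : deriv f c = 0 := by
  have hba : b - a ≠ 0 := sub_ne_zero.2 hab.symm
  have := deriv_eq_zero_of_omits_zero_one (f := fun z => (f z - a) / (b - a))
    ((hf.sub_const a).div_const _) (fun z h => by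
      rcases div_eq_zero_iff.1 h with h | h
      · exact ha z (sub_eq_zero.1 h)
      · exact hba h) (fun z h => by
      rw [div_eq_one_iff_eq hba] at h
      exact hb z (sub_left_injective h)) c
  rw [deriv_div_const, deriv_sub_const] at this
  exact (div_eq_zero_iff.1 this).resolve_right hba

theorem exists_ball_injOn {f : ℂ → ℂ} (hf : Differentiable ℂ f) {x : ℂ} (hx : deriv f x ≠ 0) :
    ∃ η > 0, InjOn f (ball x η) ∧ ∀ z ∈ ball x η, deriv f z ≠ 0 := by
  have hs : HasStrictDerivAt f (deriv f x) x := (hf.analyticAt x).hasStrictDerivAt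
  have h1 := hs.eventually_left_inverse hx
  have h2 : ∀ᶠ z in 𝓝 x, deriv f z ≠ 0 :=
    (hf.deriv.continuous.continuousAt).eventually_ne hx
  obtain ⟨η, hη, h⟩ := Metric.eventually_nhds_iff_ball.1 (h1.and h2)
  refine ⟨η, hη, fun a ha b hb hab => ?_, fun z hz => (h z hz).2⟩
  rw [← (h a ha).1, ← (h b hb).1, hab]

/-- Preimages of null sets under nonconstant entire functions are null. -/
theorem volume_preimage_eq_zero {f : ℂ → ℂ} (hf : Differentiable ℂ f) {c : ℂ}
    (hc : deriv f c ≠ 0) {N : Set ℂ} (hN : volume N = 0) : volume (f ⁻¹' N) = 0 := by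
  have hcrit : volume {z | deriv f z = 0} = 0 := by
    refine measure_null_of_locally_null _ fun x _ => ?_
    have h1 : ∀ᶠ z in 𝓝[≠] x, deriv f z ≠ 0 := by
      by_contra h2
      have h3 : ∃ᶠ z in 𝓝[≠] x, deriv f z = 0 := (not_eventually.1 h2).mono fun z hz => not_not.1 hz
      have hA : AnalyticOnNhd ℂ (deriv f) univ := fun z _ => hf.deriv.analyticAt z
      exact hc (hA.eqOn_zero_of_preconnected_of_frequently_eq_zero isPreconnected_univ
        (mem_univ x) h3 (mem_univ c))
    refine ⟨{x}, ?_, by simp⟩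
    rw [eventually_nhdsWithin_iff] at h1
    filter_upwards [mem_nhdsWithin_of_mem_nhds h1, self_mem_nhdsWithin] with z hz hz0
    by_contra hne
    exact hz hne hz0
  have hreg : volume (f ⁻¹' N ∩ {z | deriv f z ≠ 0}) = 0 := by
    refine measure_null_of_locally_null _ fun x hx => ?_
    obtain ⟨η, hη, hi, h0⟩ := exists_ball_injOn hf hx.2
    obtain ⟨k, hk, hk'⟩ := exists_inverse_of_injOn isOpen_ball hf.differentiableOn hi h0
    refine ⟨ball x η ∩ f ⁻¹' N, ?_, ?_⟩
    · filter_upwards [mem_nhdsWithin_of_mem_nhds (ball_mem_nhds x hη), self_mem_nhdsWithin] with z hz hz2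
      exact ⟨hz, hz2.1⟩
    · have hnull : volume (N ∩ f '' ball x η) = 0 := measure_mono_null inter_subset_left hN
      have hdk : DifferentiableOn ℝ k (N ∩ f '' ball x η) := by
        rintro _ ⟨-, z, hz, rfl⟩
        exact ((hk' z hz).differentiableAt.restrictScalars ℝ).differentiableWithinAt
      refine measure_mono_null ?_
        (addHaar_image_eq_zero_of_differentiableOn_of_addHaar_eq_zero volume hdk hnull)
      rintro z ⟨hz, hzN⟩
      exact ⟨f z, ⟨hzN, z, hz, rfl⟩, hk z hz⟩
  refine measure_mono_null ?_ (measure_union_null hcrit hreg)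
  intro z hz
  by_cases h : deriv f z = 0
  · exact Or.inl h
  · exact Or.inr ⟨hz, h⟩

/-- Distortion bound for locally univalent functions that are injective on discs of a fixed
radius. -/
theorem exists_distortion_bound {B : ℝ} (hB : 0 < B) : ∃ C : ℝ, 0 < C ∧ ∀ (g : ℂ → ℂ) (c : ℂ),
    DifferentiableOn ℂ g (ball c (B + 3)) → (∀ z ∈ ball c (B + 3), deriv g z ≠ 0) →
    (∀ x ∈ ball c B, InjOn g (ball x 3)) →
    ∀ x ∈ ball c B, ‖deriv g x‖ ≤ C * ‖deriv g c‖ ∧ ‖deriv g c‖ ≤ C * ‖deriv g x‖ := by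
  obtain ⟨C₀, hC₀, H⟩ := exists_second_deriv_bound
  refine ⟨Real.exp (C₀ * B), by positivity, fun g c hg h0 hi x hx => ?_⟩
  have hsub : ball c B ⊆ ball c (B + 3) := ball_subset_ball (by linarith)
  have hgd := hg.deriv isOpen_ball
  obtain ⟨L, hL, hLg⟩ := exists_log_on_ball hgd h0
  have hL' : ∀ z ∈ ball c B, ‖deriv L z‖ ≤ C₀ := by
    intro z hz
    have hz' := isOpen_ball.mem_nhds (hsub hz)
    have hs3 : ball z 3 ⊆ ball c (B + 3) := by
      apply ball_subset_ball'
      rw [mem_ball] at hz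
      linarith
    have h1 := H g z 3 (by norm_num) (hg.mono hs3) (hi z hz) (fun w hw => h0 w (hs3 hw))
    have h2 : deriv (deriv g) z = deriv g z * deriv L z := by
      have h3 : (fun z => Complex.exp (L z)) =ᶠ[𝓝 z] deriv g := by
        filter_upwards [hz'] with w hw using hLg w hw
      rw [← h3.deriv_eq, (hL.differentiableAt hz').hasDerivAt.cexp.deriv, hLg z (hsub hz)]
    rw [h2, norm_mul] at h1
    have h4 : 0 < ‖deriv g z‖ := norm_pos_iff.2 (h0 z (hsub hz))
    have h5 : ‖deriv g z‖ * (‖deriv L z‖ * 3) ≤ ‖deriv g z‖ * C₀ := by linarith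
    have h6 := le_of_mul_le_mul_left h5 h4
    have := norm_nonneg (deriv L z)
    linarith
  have hb : ∀ x ∈ ball c B, ∀ y ∈ ball c B, ‖x - y‖ ≤ B → ‖deriv g x‖ ≤
      Real.exp (C₀ * B) * ‖deriv g y‖ := by
    intro x hx y hy hxy
    have h1 := Convex.norm_image_sub_le_of_norm_deriv_le
      (fun x hx => hL.differentiableAt (isOpen_ball.mem_nhds (hsub hx))) hL' (convex_ball c B) hy hx
    have h2 : deriv g x = Complex.exp (L x - L y) * deriv g y := by
      rw [← hLg x (hsub hx), ← hLg y (hsub hy), ← Complex.exp_add]; ring_nf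
    rw [h2, norm_mul, Complex.norm_exp]
    gcongr
    refine (Complex.re_le_norm _).trans (h1.trans ?_)
    gcongr
  have hcB : c ∈ ball c B := mem_ball_self hB
  rw [mem_ball, dist_eq_norm] at hx
  have hx' : x ∈ ball c B := by rwa [mem_ball, dist_eq_norm]
  exact ⟨hb x hx' c hcB hx.le, hb c hcB x hx' (by rw [norm_sub_rev]; exact hx.le)⟩

theorem mul_volume_le_volume_image {g : ℂ → ℂ} {O Q : Set ℂ} {m : ℝ} (hO : IsOpen O)
    (hg : DifferentiableOn ℂ g O) (hQO : Q ⊆ O) (hQ : MeasurableSet Q) (hi : InjOn g Q)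
    (hm : 0 ≤ m) (hmg : ∀ x ∈ Q, m ≤ ‖deriv g x‖) :
    ENNReal.ofReal (m ^ 2) * volume Q ≤ volume (g '' Q) := by
  have hd : ∀ x ∈ Q, HasFDerivWithinAt g
      ((ContinuousLinearMap.toSpanSingleton ℂ (deriv g x)).restrictScalars ℝ) Q x := by
    intro x hx
    have h1 := (hg.differentiableAt (hO.mem_nhds (hQO hx))).hasDerivAt.hasFDerivAt
    exact (h1.restrictScalars ℝ).hasFDerivWithinAt
  have hdet : ∀ a : ℂ, |((ContinuousLinearMap.toSpanSingleton ℂ a).restrictScalars ℝ).det| =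
      ‖a‖ ^ 2 := by
    intro a
    simp [ContinuousLinearMap.det, LinearMap.det_restrictScalars,
      Algebra.norm_complex_eq, Complex.normSq_eq_norm_sq]
  rw [← lintegral_abs_det_fderiv_eq_addHaar_image volume hQ hd hi, ← setLIntegral_const]
  refine setLIntegral_mono' hQ fun x hx => ?_
  rw [hdet]
  exact ENNReal.ofReal_le_ofReal (pow_le_pow_left₀ hm (hmg x hx) 2)

/-- The filled Julia set of a polynomial. -/
def filledJuliaSet (p : Polynomial ℂ) : Set ℂ :=
  {z | ¬ Tendsto (fun n => ‖(fun w => p.eval w)^[n] z‖) atTop atTop}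

/-- `R` is a radius outside of which the polynomial `p` at least doubles the modulus. -/
structure IsEscapeRadius (p : Polynomial ℂ) (R : ℝ) : Prop where
  one_le : 1 ≤ R
  two_mul_le : ∀ z : ℂ, R ≤ ‖z‖ → 2 * ‖z‖ ≤ ‖p.eval z‖

theorem exists_isEscapeRadius {p : Polynomial ℂ} (hd : 2 ≤ p.natDegree) :
    ∃ R : ℝ, IsEscapeRadius p R := by
  have h1 : 0 < p.divX.degree := by
    rw [← Polynomial.natDegree_pos_iff_degree_pos, Polynomial.natDegree_divX_eq_natDegree_tsub_one]
    omega
  have h2 : Tendsto (fun z : ℂ => ‖p.divX.eval z‖) (Bornology.cobounded ℂ) atTop :=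
    Polynomial.tendsto_norm_atTop _ h1 tendsto_norm_cobounded_atTop
  obtain ⟨S, hS⟩ := (hasBasis_cobounded_norm.eventually_iff.1 (h2.eventually_ge_atTop 3))
  refine ⟨max (max 1 S) ‖p.coeff 0‖, le_max_of_le_left (le_max_left _ _), fun z hz => ?_⟩
  have hz1 : S ≤ ‖z‖ := ((le_max_right _ _).trans (le_max_left _ _)).trans hz
  have hz2 : ‖p.coeff 0‖ ≤ ‖z‖ := (le_max_right _ _).trans hz
  have h3 := hS.2 hz1
  have h4 : p.eval z = z * p.divX.eval z + p.coeff 0 := by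
    have h := congrArg (Polynomial.eval z) (Polynomial.X_mul_divX_add p)
    simp only [Polynomial.eval_add, Polynomial.eval_mul, Polynomial.eval_X,
      Polynomial.eval_C] at h
    exact h.symm
  rw [h4]
  have h5 := norm_sub_le (z * p.divX.eval z + p.coeff 0) (p.coeff 0)
  rw [add_sub_cancel_right, norm_mul] at h5
  have h6 : ‖z‖ * 3 ≤ ‖z‖ * ‖p.divX.eval z‖ := by
    gcongr
  linarith

theorem not_eventually_eval_eq {p : Polynomial ℂ} (hd : 2 ≤ p.natDegree) (x : ℂ) :
    ¬ ∀ᶠ z in 𝓝 x, p.eval z = p.eval x := by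
  intro hc
  have h1 : {z | (p - Polynomial.C (p.eval x)).IsRoot z}.Finite := by
    refine Polynomial.finite_setOfPred_isRoot fun h0 => ?_
    rw [sub_eq_zero.1 h0, Polynomial.natDegree_C] at hd
    omega
  have h2 : {z | (p - Polynomial.C (p.eval x)).IsRoot z} ∈ 𝓝 x := by
    filter_upwards [hc] with z hz
    simp [hz]
  exact infinite_of_mem_nhds x h2 h1

section

variable {p : Polynomial ℂ} {R : ℝ}

theorem continuous_iterate_eval (p : Polynomial ℂ) (n : ℕ) :
    Continuous ((fun w => p.eval w)^[n]) := p.continuous.iterate n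

theorem differentiable_iterate_eval (p : Polynomial ℂ) (n : ℕ) :
    Differentiable ℂ ((fun w => p.eval w)^[n]) := p.differentiable.iterate n

theorem IsEscapeRadius.pow_mul_le (h : IsEscapeRadius p R) {z : ℂ} (hz : R ≤ ‖z‖) (k : ℕ) :
    2 ^ k * ‖z‖ ≤ ‖(fun w => p.eval w)^[k] z‖ := by
  induction k with
  | zero => simp
  | succ k ih =>
    rw [Function.iterate_succ_apply']
    have h1 : R ≤ ‖(fun w => p.eval w)^[k] z‖ := by
      refine le_trans ?_ ih
      have : (1 : ℝ) ≤ 2 ^ k := one_le_pow₀ (by norm_num)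
      nlinarith [norm_nonneg z]
    have := h.two_mul_le _ h1
    rw [pow_succ]
    linarith

theorem IsEscapeRadius.tendsto (h : IsEscapeRadius p R) {z : ℂ} {n : ℕ}
    (hz : R ≤ ‖(fun w => p.eval w)^[n] z‖) :
    Tendsto (fun n => ‖(fun w => p.eval w)^[n] z‖) atTop atTop := by
  rw [← tendsto_add_atTop_iff_nat n]
  refine tendsto_atTop_mono (f := fun k : ℕ => (2 : ℝ) ^ k) (fun k => ?_)
    (tendsto_pow_atTop_atTop_of_one_lt (by norm_num))
  have h1 := h.pow_mul_le hz k
  rw [← Function.iterate_add_apply] at h1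
  refine le_trans ?_ h1
  have : (1 : ℝ) ≤ ‖(fun w => p.eval w)^[n] z‖ := h.one_le.trans hz
  exact le_mul_of_one_le_right (by positivity) this

theorem IsEscapeRadius.mem_filled_iff_lt (h : IsEscapeRadius p R) {z : ℂ} :
    z ∈ filledJuliaSet p ↔ ∀ n : ℕ, ‖(fun w => p.eval w)^[n] z‖ < R := by
  refine ⟨fun hz n => not_le.1 fun hn => hz (h.tendsto hn), fun hz ht => ?_⟩
  obtain ⟨n, hn⟩ := (ht.eventually_ge_atTop R).exists
  exact (hz n).not_ge hn

theorem IsEscapeRadius.mem_filled_iff_le (h : IsEscapeRadius p R) {z : ℂ} :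
    z ∈ filledJuliaSet p ↔ ∀ n : ℕ, ‖(fun w => p.eval w)^[n] z‖ ≤ R := by
  refine ⟨fun hz n => (h.mem_filled_iff_lt.1 hz n).le, fun hz ht => ?_⟩
  obtain ⟨n, hn⟩ := (ht.eventually_gt_atTop R).exists
  exact (hz n).not_gt hn

theorem IsEscapeRadius.isCompact_filled (h : IsEscapeRadius p R) :
    IsCompact (filledJuliaSet p) := by
  have h1 : filledJuliaSet p = ⋂ n : ℕ, {z | ‖(fun w => p.eval w)^[n] z‖ ≤ R} := by
    ext z
    rw [h.mem_filled_iff_le]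
    simp
  refine (isCompact_closedBall (0 : ℂ) R).of_isClosed_subset ?_ fun z hz => ?_
  · rw [h1]
    exact isClosed_iInter fun n =>
      isClosed_le (continuous_iterate_eval p n).norm continuous_const
  · simpa using h.mem_filled_iff_le.1 hz 0

theorem eval_mem_filled_iff {z : ℂ} : p.eval z ∈ filledJuliaSet p ↔ z ∈ filledJuliaSet p := by
  have := tendsto_add_atTop_iff_nat (f := fun n => ‖(fun w => p.eval w)^[n] z‖) (l := atTop) 1
  simp only [Function.iterate_succ_apply] at this
  exact not_congr this

theorem IsEscapeRadius.julia_subset_filled (h : IsEscapeRadius p R) :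
    juliaSet (fun w => p.eval w) ⊆ filledJuliaSet p := by
  intro z hz
  by_contra hn
  apply hz
  obtain ⟨n, hn⟩ := ((not_not.1 hn).eventually_gt_atTop R).exists
  refine ⟨{x | R < ‖(fun w => p.eval w)^[n] x‖},
    (isOpen_lt continuous_const (continuous_iterate_eval p n).norm).mem_nhds hn,
    fun φ hφ => ⟨id, strictMono_id, fun _ => none, fun K hK _ ε hε => ?_⟩⟩
  have h1 : Tendsto (fun k : ℕ => (2 : ℝ) ^ (φ k - n)) atTop atTop :=
    (tendsto_pow_atTop_atTop_of_one_lt (by norm_num)).comp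
      ((tendsto_sub_atTop_nat n).comp hφ.tendsto_atTop)
  filter_upwards [h1.eventually_gt_atTop (2 / ε), hφ.tendsto_atTop.eventually_ge_atTop n]
    with k hk hkn z hz
  have h2 := h.pow_mul_le (hK hz).le (φ k - n)
  rw [← Function.iterate_add_apply, Nat.sub_add_cancel hkn] at h2
  have h3 : (1 : ℝ) ≤ ‖(fun w => p.eval w)^[n] z‖ := h.one_le.trans (hK hz).le
  simp only [id, chordalDist]
  set w := (fun w => p.eval w)^[φ k] z
  have h4 : 2 / ε < ‖w‖ := hk.trans_le ((le_mul_of_one_le_right (by positivity) h3).trans h2)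
  have h5 : ‖w‖ ≤ Real.sqrt (1 + ‖w‖ ^ 2) := Real.le_sqrt_of_sq_le (by linarith)
  rw [div_lt_iff₀ hε] at h4
  have h6 : 0 < Real.sqrt (1 + ‖w‖ ^ 2) := by positivity
  rw [div_lt_iff₀ h6]
  nlinarith

theorem mem_julia_of_eval_mem (hd : 2 ≤ p.natDegree) {x : ℂ}
    (hx : p.eval x ∈ juliaSet (fun w => p.eval w)) : x ∈ juliaSet (fun w => p.eval w) := by
  intro hF
  apply hx
  obtain ⟨U, hU, hUn⟩ := hF
  obtain ⟨ε, hε, hεU⟩ := Metric.nhds_basis_closedBall.mem_iff.1 hU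
  have hopen : 𝓝 (p.eval x) ≤ map (fun w => p.eval w) (𝓝 x) :=
    (AnalyticAt.eventually_constant_or_nhds_le_map_nhds
      (p.differentiable.analyticAt x)).resolve_left (not_eventually_eval_eq hd x)
  set V := (fun w => p.eval w) '' closedBall x ε with hV
  have hVn : V ∈ 𝓝 (p.eval x) := hopen (image_mem_map (closedBall_mem_nhds x hε))
  refine ⟨V, hVn, fun φ hφ => ?_⟩
  obtain ⟨ψ, hψ, g, hg⟩ := hUn (fun n => φ n + 1) (fun a b hab => by simpa using hφ hab)
  have hex : ∀ y : ℂ, ∃ z : ℂ, y ∈ V → z ∈ closedBall x ε ∧ p.eval z = y := by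
    intro y
    by_cases hy : y ∈ V
    · obtain ⟨z, hz, rfl⟩ := hy
      exact ⟨z, fun _ => ⟨hz, rfl⟩⟩
    · exact ⟨0, fun h => absurd h hy⟩
  choose s hs using hex
  refine ⟨ψ, hψ, fun y => g (s y), fun K hK _ δ hδ => ?_⟩
  filter_upwards [hg (closedBall x ε) hεU (isCompact_closedBall x ε) δ hδ] with n hn y hy
  have := hn (s y) (hs y (hK hy)).1
  simp only [Function.iterate_succ_apply, (hs y (hK hy)).2] at this
  exact this

end

/-- Logarithms of the ratios `(z - x) / (z - y)` for `x`, `y` in a preconnected set. -/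
theorem exists_log_ratio {J O : Set ℂ} (hJ : IsPreconnected J) {δ : ℝ} (hδ : 0 < δ)
    (hd : ∀ x ∈ J, ∀ z ∈ O, δ ≤ ‖z - x‖) {x y : ℂ} (hx : x ∈ J) (hy : y ∈ J) :
    ∃ L : ℂ → ℂ, DifferentiableOn ℂ L O ∧ ∀ z ∈ O, Complex.exp (L z) = (z - x) / (z - y) := by
  have hne : ∀ x ∈ J, ∀ z ∈ O, z - x ≠ 0 := fun x hx z hz =>
    norm_pos_iff.1 (hδ.trans_le (hd x hx z hz))
  refine hJ.induction₂ (fun x y => ∃ L : ℂ → ℂ, DifferentiableOn ℂ L O ∧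
    ∀ z ∈ O, Complex.exp (L z) = (z - x) / (z - y)) ?_ ?_ ?_ hx hy
  · intro x hx
    filter_upwards [self_mem_nhdsWithin, mem_nhdsWithin_of_mem_nhds (ball_mem_nhds x hδ)]
      with y hy hyx
    have hs : ∀ z ∈ O, (z - x) / (z - y) ∈ Complex.slitPlane := by
      intro z hz
      have h1 : (z - x) / (z - y) = 1 + (y - x) / (z - y) := by
        field_simp [hne y hy z hz]
        ring
      rw [h1]
      apply Complex.mem_slitPlane_of_norm_lt_one
      rw [norm_div, div_lt_one (hδ.trans_le (hd y hy z hz))]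
      rw [mem_ball, dist_eq_norm] at hyx
      exact hyx.trans_le (hd y hy z hz)
    refine ⟨fun z => Complex.log ((z - x) / (z - y)), ?_, fun z hz => ?_⟩
    · refine DifferentiableOn.clog (DifferentiableOn.div (by fun_prop) (by fun_prop)
        fun z hz => hne y hy z hz) hs
    · exact Complex.exp_log (div_ne_zero (hne x hx z hz) (hne y hy z hz))
  · rintro x y z hx hy hz ⟨L, hL, hLe⟩ ⟨M, hM, hMe⟩
    refine ⟨L + M, hL.add hM, fun w hw => ?_⟩
    rw [Pi.add_apply, Complex.exp_add, hLe w hw, hMe w hw,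
      div_mul_div_cancel₀ (hne y hy w hw)]
  · rintro x y hx hy ⟨L, hL, hLe⟩
    refine ⟨-L, hL.neg, fun w hw => ?_⟩
    rw [Pi.neg_apply, Complex.exp_neg, hLe w hw, inv_div]

/-- The points whose `n`-th iterate has modulus greater than `R`. -/
def escapeDomain (p : Polynomial ℂ) (R : ℝ) (n : ℕ) : Set ℂ :=
  {z | R < ‖(fun w => p.eval w)^[n] z‖}

section

variable {p : Polynomial ℂ} {R : ℝ} {n : ℕ}

theorem isOpen_escapeDomain (p : Polynomial ℂ) (R : ℝ) (n : ℕ) : IsOpen (escapeDomain p R n) :=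
  isOpen_lt continuous_const (continuous_iterate_eval p n).norm

theorem eval_mem_escapeDomain {z : ℂ} :
    p.eval z ∈ escapeDomain p R n ↔ z ∈ escapeDomain p R (n + 1) := Iff.rfl

theorem IsEscapeRadius.exists_separation (h : IsEscapeRadius p R) (n : ℕ) :
    ∃ δ > 0, ∀ x ∈ filledJuliaSet p, ∀ z ∈ escapeDomain p R n, δ ≤ ‖z - x‖ := by
  have hc : IsClosed {z | R ≤ ‖(fun w => p.eval w)^[n] z‖} :=
    isClosed_le continuous_const (continuous_iterate_eval p n).norm
  have hdis : Disjoint (filledJuliaSet p) {z | R ≤ ‖(fun w => p.eval w)^[n] z‖} :=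
    Set.disjoint_left.2 fun z hz hz' => (h.mem_filled_iff_lt.1 hz n).not_ge hz'
  obtain ⟨r, hr, hrd⟩ := Metric.exists_pos_forall_lt_edist h.isCompact_filled hc hdis
  refine ⟨r, hr, fun x hx z hz => ?_⟩
  have := hrd x hx z (show R ≤ ‖(fun w => p.eval w)^[n] z‖ from le_of_lt hz)
  rw [edist_comm, edist_nndist, ENNReal.coe_lt_coe] at this
  rw [← dist_eq_norm]
  exact this.le

theorem IsEscapeRadius.exists_root (h : IsEscapeRadius p R) (hd : 2 ≤ p.natDegree)
    (hJ : IsPreconnected (juliaSet (fun w => p.eval w))) {b : ℂ}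
    (hb : b ∈ juliaSet (fun w => p.eval w)) (n : ℕ) :
    ∃ r : ℂ → ℂ, DifferentiableOn ℂ r (escapeDomain p R n) ∧
      ∀ z ∈ escapeDomain p R n, r z ^ p.natDegree = p.eval z - b := by
  set O := escapeDomain p R n
  obtain ⟨δ, hδ, hsep⟩ := h.exists_separation n
  have hsepJ : ∀ x ∈ juliaSet (fun w => p.eval w), ∀ z ∈ O, δ ≤ ‖z - x‖ :=
    fun x hx => hsep x (h.julia_subset_filled hx)
  have hms : ∀ s : Multiset ℂ, (∀ x ∈ s, x ∈ juliaSet (fun w => p.eval w)) →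
      ∃ L : ℂ → ℂ, DifferentiableOn ℂ L O ∧
        ∀ z ∈ O, (s.map (fun x => z - x)).prod = Complex.exp (L z) * (z - b) ^ s.card := by
    intro s
    induction s using Multiset.induction_on with
    | empty => exact fun _ => ⟨0, differentiableOn_const 0, by simp⟩
    | cons a s ih =>
      intro hs
      obtain ⟨L, hL, hLe⟩ := ih fun x hx => hs x (Multiset.mem_cons_of_mem hx)
      obtain ⟨M, hM, hMe⟩ := exists_log_ratio hJ hδ hsepJ (hs a (Multiset.mem_cons_self a s)) hb
      refine ⟨M + L, hM.add hL, fun z hz => ?_⟩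
      have hzb : z - b ≠ 0 := norm_pos_iff.1 (hδ.trans_le (hsepJ b hb z hz))
      rw [Multiset.map_cons, Multiset.prod_cons, hLe z hz, Pi.add_apply, Complex.exp_add,
        hMe z hz, Multiset.card_cons, pow_succ]
      field_simp
  have hdeg : (p - Polynomial.C b).natDegree = p.natDegree := Polynomial.natDegree_sub_C
  have hlc : (p - Polynomial.C b).leadingCoeff = p.leadingCoeff :=
    Polynomial.leadingCoeff_sub_of_degree_lt (by
      refine Polynomial.degree_C_le.trans_lt ?_
      rw [← Polynomial.natDegree_pos_iff_degree_pos]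
      omega)
  have hsp := IsAlgClosed.splits (p - Polynomial.C b)
  obtain ⟨L, hL, hLe⟩ := hms (p - Polynomial.C b).roots fun x hx => by
    apply mem_julia_of_eval_mem hd
    have := (Polynomial.mem_roots'.1 hx).2
    simp only [Polynomial.IsRoot, Polynomial.eval_sub, Polynomial.eval_C, sub_eq_zero] at this
    rwa [this]
  have hd0 : p.natDegree ≠ 0 := by omega
  obtain ⟨γ, hγ⟩ := IsAlgClosed.exists_pow_nat_eq p.leadingCoeff (Nat.pos_of_ne_zero hd0)
  refine ⟨fun z => γ * Complex.exp (L z / p.natDegree) * (z - b), ?_, fun z hz => ?_⟩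
  · exact ((differentiableOn_const γ).mul (hL.div_const _).cexp).mul (by fun_prop)
  · have h1 := hsp.eval_eq_prod_roots z
    rw [hLe z hz, hlc, ← hsp.natDegree_eq_card_roots, hdeg] at h1
    simp only [Polynomial.eval_sub, Polynomial.eval_C] at h1
    rw [h1, mul_pow, mul_pow, hγ, ← Complex.exp_nat_mul, mul_div_cancel₀ _ (by exact_mod_cast hd0)]
    ring

end

theorem isPreconnected_lt_norm {S : ℝ} (hS : 0 < S) : IsPreconnected {s : ℂ | S < ‖s‖} := by
  have h1 : {s : ℂ | S < ‖s‖} = Complex.exp '' {x | Real.log S < x.re} := by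
    ext s
    constructor
    · intro hs
      have hs' : S < ‖s‖ := hs
      refine ⟨Complex.log s, ?_, Complex.exp_log (norm_pos_iff.1 (hS.trans hs'))⟩
      change Real.log S < (Complex.log s).re
      rw [Complex.log_re]
      exact Real.log_lt_log hS hs'
    · rintro ⟨x, hx, rfl⟩
      change S < ‖Complex.exp x‖
      rw [Complex.norm_exp]
      exact (Real.log_lt_iff_lt_exp hS).1 hx
  rw [h1]
  exact ((convex_halfSpace_re_gt _).isPreconnected).image _ Complex.continuous_exp.continuousOn

section

variable {p : Polynomial ℂ} {R : ℝ} {n : ℕ} {b : ℂ} {r : ℂ → ℂ}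

theorem IsEscapeRadius.mem_escapeDomain (h : IsEscapeRadius p R) {z : ℂ} (hz : R < ‖z‖) (n : ℕ) :
    z ∈ escapeDomain p R n := by
  refine lt_of_lt_of_le ?_ (h.pow_mul_le hz.le n)
  have : (1 : ℝ) ≤ 2 ^ n := one_le_pow₀ (by norm_num)
  nlinarith [norm_nonneg z]

theorem isOpen_image_root (hd : 2 ≤ p.natDegree)
    (hr : DifferentiableOn ℂ r (escapeDomain p R (n + 1)))
    (hrp : ∀ z ∈ escapeDomain p R (n + 1), r z ^ p.natDegree = p.eval z - b) :
    IsOpen (r '' escapeDomain p R (n + 1)) := by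
  have hO := isOpen_escapeDomain p R (n + 1)
  rw [isOpen_iff_mem_nhds]
  rintro _ ⟨z, hz, rfl⟩
  refine ((AnalyticAt.eventually_constant_or_nhds_le_map_nhds
    (hr.analyticAt (hO.mem_nhds hz))).resolve_left fun hc => ?_)
    (image_mem_map (hO.mem_nhds hz))
  refine not_eventually_eval_eq hd z ?_
  filter_upwards [hc, hO.mem_nhds hz] with x hx hxU
  have h1 := hrp x hxU
  rw [hx, hrp z hz] at h1
  linear_combination -h1

theorem IsEscapeRadius.mem_image_root_of_mem_closure (h : IsEscapeRadius p R)
    (hr : DifferentiableOn ℂ r (escapeDomain p R (n + 1)))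
    (hrp : ∀ z ∈ escapeDomain p R (n + 1), r z ^ p.natDegree = p.eval z - b)
    {s : ℂ} (hs : b + s ^ p.natDegree ∈ escapeDomain p R n)
    (hcl : s ∈ closure (r '' escapeDomain p R (n + 1))) :
    s ∈ r '' escapeDomain p R (n + 1) := by
  obtain ⟨w, hw, hws⟩ := mem_closure_iff_seq_limit.1 hcl
  choose z hzU hzw using hw
  have hp : ∀ k, p.eval (z k) = b + w k ^ p.natDegree := fun k => by
    rw [← hzw k, hrp _ (hzU k)]; ring
  have hpt : Tendsto (fun k => p.eval (z k)) atTop (𝓝 (b + s ^ p.natDegree)) := by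
    simp only [hp]
    exact (hws.pow _).const_add _
  obtain ⟨M, hM⟩ := hpt.norm.bddAbove_range
  have hzb : ∀ k, z k ∈ closedBall (0 : ℂ) (max R M) := by
    intro k
    rw [mem_closedBall_zero_iff]
    rcases le_total R ‖z k‖ with h1 | h1
    · have h2 := h.two_mul_le _ h1
      have h3 : ‖p.eval (z k)‖ ≤ M := hM ⟨k, rfl⟩
      exact le_max_of_le_right (by linarith [norm_nonneg (z k)])
    · exact le_max_of_le_left h1
  obtain ⟨y, -, φ, hφ, hφy⟩ := (isCompact_closedBall (0 : ℂ) (max R M)).tendsto_subseq hzb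
  have h4 : p.eval y = b + s ^ p.natDegree :=
    tendsto_nhds_unique ((p.continuous.tendsto y).comp hφy) (hpt.comp hφ.tendsto_atTop)
  have hy : y ∈ escapeDomain p R (n + 1) := by
    rw [← eval_mem_escapeDomain, h4]
    exact hs
  refine ⟨y, hy, ?_⟩
  have h5 : ContinuousAt r y :=
    hr.continuousOn.continuousAt ((isOpen_escapeDomain p R (n + 1)).mem_nhds hy)
  refine tendsto_nhds_unique (h5.tendsto.comp hφy) ?_
  refine (hws.comp hφ.tendsto_atTop).congr fun k => ?_
  simp [hzw]

theorem IsEscapeRadius.surjective_root (h : IsEscapeRadius p R) (hd : 2 ≤ p.natDegree)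
    (hr : DifferentiableOn ℂ r (escapeDomain p R (n + 1)))
    (hrp : ∀ z ∈ escapeDomain p R (n + 1), r z ^ p.natDegree = p.eval z - b)
    {s : ℂ} (hs : b + s ^ p.natDegree ∈ escapeDomain p R n) :
    s ∈ r '' escapeDomain p R (n + 1) := by
  set W := r '' escapeDomain p R (n + 1) with hW
  set d := p.natDegree
  set O := {s : ℂ | b + s ^ d ∈ escapeDomain p R n} with hOdef
  have hR := h.one_le
  have hWopen : IsOpen W := isOpen_image_root hd hr hrp
  have hOopen : IsOpen O := (isOpen_escapeDomain p R n).preimage (by fun_prop)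
  have hV : O \ W = O \ closure W := by
    ext x
    refine and_congr_right fun hx => not_congr ⟨fun h => subset_closure h, fun hx' => ?_⟩
    exact h.mem_image_root_of_mem_closure hr hrp hx hx'
  have hVopen : IsOpen (O \ W) := by
    rw [hV]
    exact hOopen.sdiff isClosed_closure
  set S := R + ‖b‖ with hS
  have hS1 : 1 ≤ S := by linarith [norm_nonneg b]
  have hTO : {s : ℂ | S < ‖s‖} ⊆ O := by
    intro s hs
    have hs' : S < ‖s‖ := hs
    refine h.mem_escapeDomain ?_ n
    have h1 : ‖s‖ ≤ ‖s ^ d‖ := by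
      rw [norm_pow]
      exact le_self_pow₀ (by linarith) (by omega)
    have h2 := norm_sub_le (b + s ^ d) b
    rw [add_sub_cancel_left] at h2
    linarith
  have hTW : {s : ℂ | S < ‖s‖} ⊆ W := by
    refine (isPreconnected_lt_norm (by linarith)).subset_left_of_subset_union hWopen hVopen
      disjoint_sdiff_right (fun x hx => ?_) ?_
    · by_cases hxW : x ∈ W
      · exact Or.inl hxW
      · exact Or.inr ⟨hTO hx, hxW⟩
    · set t : ℝ := R + S ^ d + ‖b‖
      have hSd : 0 ≤ S ^ d := by positivity
      have ht : ‖(t : ℂ)‖ = t := by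
        rw [Complex.norm_real, Real.norm_of_nonneg]
        positivity
      have h0 : R < t := by
        have : 0 < S ^ d := by positivity
        linarith [norm_nonneg b]
      have h1 : (t : ℂ) ∈ escapeDomain p R (n + 1) := h.mem_escapeDomain (by rwa [ht]) _
      refine ⟨r t, ?_, t, h1, rfl⟩
      change S < ‖r t‖
      have h2 := h.two_mul_le t (by rw [ht]; exact h0.le)
      have h3 := norm_sub_le (p.eval (t : ℂ) - b) (-b)
      rw [sub_neg_eq_add, sub_add_cancel, norm_neg, ← hrp _ h1, norm_pow] at h3
      rw [ht] at h2
      have h4 : S ^ d < ‖r t‖ ^ d := by linarith [norm_nonneg b]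
      exact lt_of_pow_lt_pow_left₀ d (norm_nonneg _) h4
  by_contra hsW
  have hb : Bornology.IsBounded (O \ W) := by
    refine (isBounded_closedBall (x := (0 : ℂ)) (r := S)).subset fun x hx => ?_
    rw [mem_closedBall_zero_iff]
    by_contra hx'
    exact hx.2 (hTW (not_le.1 hx'))
  have hdiff : Differentiable ℂ fun x : ℂ => (fun w => p.eval w)^[n] (b + x ^ d) :=
    (differentiable_iterate_eval p n).comp (by fun_prop)
  have hle := Complex.norm_le_of_forall_mem_frontier_norm_le hb (hdiff.diffContOnCl)
    (C := R) (fun x hx => ?_) (subset_closure (⟨hs, hsW⟩ : s ∈ O \ W))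
  · have hs' : R < ‖(fun w => p.eval w)^[n] (b + s ^ d)‖ := hs
    exact hle.not_gt hs'
  · rw [hVopen.frontier_eq] at hx
    by_contra hlt
    have hxO : x ∈ O := not_le.1 hlt
    have hxW : x ∈ W := by
      by_contra hxW
      exact hx.2 ⟨hxO, hxW⟩
    obtain ⟨y, hy1, hy2⟩ := mem_closure_iff.1 hx.1 W hWopen hxW
    exact hy2.2 hy1

theorem IsEscapeRadius.root_ne_zero (h : IsEscapeRadius p R) (hd : 2 ≤ p.natDegree)
    (hb : b ∈ filledJuliaSet p)
    (hrp : ∀ z ∈ escapeDomain p R (n + 1), r z ^ p.natDegree = p.eval z - b)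
    {c : ℂ} (hc : c ∈ escapeDomain p R (n + 1)) : r c ≠ 0 := by
  intro h0
  have h1 := hrp c hc
  rw [h0, zero_pow (by omega), eq_comm, sub_eq_zero] at h1
  rw [← eval_mem_escapeDomain, h1] at hc
  exact (h.mem_filled_iff_lt.1 hb n).not_gt hc

theorem IsEscapeRadius.root_fiber (h : IsEscapeRadius p R) (hd : 2 ≤ p.natDegree)
    (hb : b ∈ filledJuliaSet p)
    (hr : DifferentiableOn ℂ r (escapeDomain p R (n + 1)))
    (hrp : ∀ z ∈ escapeDomain p R (n + 1), r z ^ p.natDegree = p.eval z - b)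
    {c : ℂ} (hc : c ∈ escapeDomain p R (n + 1)) :
    p.derivative.eval c ≠ 0 ∧ ∀ z ∈ escapeDomain p R (n + 1), r z = r c → z = c := by
  have h0 : r c ≠ 0 := h.root_ne_zero hd hb hrp hc
  have hd0 : p.natDegree ≠ 0 := by omega
  set d := p.natDegree with hddef
  have hζ := Complex.isPrimitiveRoot_exp d hd0
  set ζ := Complex.exp (2 * Real.pi * Complex.I / d)
  have hex : ∀ i : Fin d, ∃ z ∈ escapeDomain p R (n + 1), r z = ζ ^ (i : ℕ) * r c := by
    intro i
    refine h.surjective_root hd hr hrp ?_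
    rw [mul_pow, ← pow_mul, mul_comm (i : ℕ), pow_mul, hζ.pow_eq_one, one_pow, one_mul,
      hrp c hc, add_sub_cancel]
    exact hc
  choose z hzU hzr using hex
  have hzi : Function.Injective z := by
    intro i j hij
    have h1 := hzr i
    rw [hij, hzr j] at h1
    exact Fin.ext (hζ.pow_inj j.2 i.2 (mul_right_cancel₀ h0 h1)).symm
  set q := p - Polynomial.C (p.eval c) with hq
  have hqd : q.natDegree = d := Polynomial.natDegree_sub_C
  have hq0 : q ≠ 0 := by
    intro h
    rw [h, Polynomial.natDegree_zero] at hqd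
    omega
  have hpz : ∀ y ∈ escapeDomain p R (n + 1), ∀ i : Fin d, r y = ζ ^ (i : ℕ) * r c →
      p.eval y = p.eval c := by
    intro y hy i hyr
    have h1 := hrp y hy
    rw [hyr, mul_pow, ← pow_mul, mul_comm (i : ℕ), pow_mul, hζ.pow_eq_one, one_pow, one_mul,
      hrp c hc] at h1
    linear_combination -h1
  have hsub : Finset.univ.image z ⊆ q.roots.toFinset := by
    intro y hy
    obtain ⟨i, -, rfl⟩ := Finset.mem_image.1 hy
    rw [Multiset.mem_toFinset, Polynomial.mem_roots hq0]
    simp [hq, hpz _ (hzU i) i (hzr i)]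
  have hcard : (Finset.univ.image z).card = d := by
    rw [Finset.card_image_of_injective _ hzi, Finset.card_univ, Fintype.card_fin]
  have h1 : q.roots.toFinset.card ≤ q.roots.card := Multiset.toFinset_card_le _
  have h2 : q.roots.card ≤ d := hqd ▸ Polynomial.card_roots' q
  have h3 := Finset.card_le_card hsub
  have heq : Finset.univ.image z = q.roots.toFinset :=
    Finset.eq_of_subset_of_card_le hsub (by omega)
  have hnd : q.roots.Nodup := Multiset.toFinset_card_eq_card_iff_nodup.1 (by omega)
  have hmem : ∀ y ∈ escapeDomain p R (n + 1), r y = r c → y = z ⟨0, by omega⟩ := by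
    intro y hy hyr
    have h4 : y ∈ q.roots.toFinset := by
      rw [Multiset.mem_toFinset, Polynomial.mem_roots hq0]
      simp [hq, hpz _ hy ⟨0, by omega⟩ (by simpa using hyr)]
    rw [← heq] at h4
    obtain ⟨i, -, rfl⟩ := Finset.mem_image.1 h4
    congr 1
    have h5 := hzr i
    rw [hyr] at h5
    have h6 : ζ ^ (i : ℕ) = ζ ^ 0 := by
      apply mul_right_cancel₀ h0
      rw [← h5]; simp
    exact Fin.ext (hζ.pow_inj i.2 (by omega) h6)
  refine ⟨fun hder => ?_, fun y hy hyr => (hmem y hy hyr).trans (hmem c hc rfl).symm⟩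
  have h4 : 1 < q.rootMultiplicity c := by
    rw [Polynomial.one_lt_rootMultiplicity_iff_isRoot hq0]
    simp [hq, hder]
  rw [← Polynomial.count_roots] at h4
  exact h4.not_ge (Multiset.nodup_iff_count_le_one.1 hnd c)

theorem IsEscapeRadius.exists_lift (h : IsEscapeRadius p R) (hd : 2 ≤ p.natDegree)
    (hJ : IsConnected (juliaSet (fun w => p.eval w))) (n : ℕ) {A : ℂ → ℂ} {c a : ℂ} {ρ : ℝ}
    (hρ : 0 < ρ) (hA : DifferentiableOn ℂ A (ball c ρ))
    (hAU : ∀ x ∈ ball c ρ, A x ∈ escapeDomain p R n) (ha : p.eval a = A c) :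
    ∃ A' : ℂ → ℂ, DifferentiableOn ℂ A' (ball c ρ) ∧ (∀ x ∈ ball c ρ, p.eval (A' x) = A x) ∧
      A' c = a := by
  obtain ⟨b, hbJ⟩ := hJ.nonempty
  have hb := h.julia_subset_filled hbJ
  obtain ⟨r, hr, hrp⟩ := h.exists_root hd hJ.isPreconnected hbJ (n + 1)
  have hcB : c ∈ ball c ρ := mem_ball_self hρ
  have hd0 : p.natDegree ≠ 0 := by omega
  have hO := isOpen_escapeDomain p R (n + 1)
  obtain ⟨k, hkr, hk⟩ := exists_inverse_of_injOn hO hr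
    (fun x hx y hy hxy => (h.root_fiber hd hb hr hrp hy).2 x hx hxy) (by
      intro z hz h0
      apply (h.root_fiber hd hb hr hrp hz).1
      have h1 : HasDerivAt r (deriv r z) z := (hr.differentiableAt (hO.mem_nhds hz)).hasDerivAt
      have h2 := h1.pow p.natDegree
      rw [h0, mul_zero] at h2
      have h3 : HasDerivAt (fun y => p.eval y - b) 0 z := by
        refine h2.congr_of_eventuallyEq ?_
        filter_upwards [hO.mem_nhds hz] with y hy
        rw [Pi.pow_apply, hrp y hy]
      exact (((p.hasDerivAt z).sub_const b).unique h3))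
  have hne : ∀ x ∈ ball c ρ, A x - b ≠ 0 := by
    intro x hx h0
    have h1 := hAU x hx
    rw [sub_eq_zero.1 h0] at h1
    exact (h.mem_filled_iff_lt.1 hb n).not_gt h1
  obtain ⟨L, hL, hLe⟩ := exists_log_on_ball (hA.sub_const b) hne
  have haU : a ∈ escapeDomain p R (n + 1) := by
    rw [← eval_mem_escapeDomain, ha]
    exact hAU c hcB
  set s : ℂ → ℂ := fun x => Complex.exp (L x / p.natDegree - L c / p.natDegree) * r a with hs
  have hsd : ∀ x ∈ ball c ρ, s x ^ p.natDegree = A x - b := by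
    intro x hx
    have hdc : (p.natDegree : ℂ) ≠ 0 := by exact_mod_cast hd0
    rw [hs]
    simp only
    rw [mul_pow, hrp a haU, ha, ← Complex.exp_nat_mul, ← hLe x hx, ← hLe c hcB, ← Complex.exp_add]
    congr 1
    field_simp
    ring
  have hsd' : DifferentiableOn ℂ s (ball c ρ) :=
    ((hL.div_const _).sub_const _).cexp.mul_const _
  have hsU : ∀ x ∈ ball c ρ, ∃ z ∈ escapeDomain p R (n + 1), r z = s x := by
    intro x hx
    refine h.surjective_root hd hr hrp ?_
    rw [hsd x hx, add_sub_cancel]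
    exact hAU x hx
  refine ⟨k ∘ s, fun x hx => ?_, fun x hx => ?_, ?_⟩
  · obtain ⟨z, hz, hzs⟩ := hsU x hx
    have := (hk z hz).differentiableAt
    rw [hzs] at this
    exact this.comp_differentiableWithinAt x (hsd' x hx)
  · obtain ⟨z, hz, hzs⟩ := hsU x hx
    have h1 := hrp z hz
    rw [hzs, hsd x hx] at h1
    rw [Function.comp_apply, ← hzs, hkr z hz]
    linear_combination -h1
  · have : s c = r a := by simp [hs]
    rw [Function.comp_apply, this, hkr a haU]

end

/-- A linearizing function of a polynomial at a repelling fixed point is locally injective at the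
origin unless it is constant. -/
theorem deriv_ne_zero_of_linearizing {p : Polynomial ℂ} {z₀ lam : ℂ}
    (hlam : deriv (fun w => p.eval w) z₀ = lam) (hlam1 : 1 < ‖lam‖) {f : ℂ → ℂ}
    (hf : Differentiable ℂ f) (hf0 : f 0 = z₀) (hfe : ∀ z, f (lam * z) = p.eval (f z))
    (hnc : ¬ ∀ z, f z = z₀) : deriv f 0 ≠ 0 := by
  have hl0 : lam ≠ 0 := norm_pos_iff.1 (by linarith)
  have hfix : p.eval z₀ = z₀ := by
    have := hfe 0
    rw [mul_zero, hf0] at this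
    exact this.symm
  have h1 : ¬ ∀ᶠ z in 𝓝 (0 : ℂ), f z - z₀ = 0 := by
    intro h
    refine hnc fun z => ?_
    have h2 := AnalyticOnNhd.eq_of_eventuallyEq (f := f) (g := fun _ => z₀)
      (fun x _ => hf.analyticAt x) (fun x _ => analyticAt_const)
      (h.mono fun x hx => sub_eq_zero.1 hx)
    exact congrFun h2 z
  obtain ⟨n, g, hg, hg0, hfg⟩ :=
    (AnalyticAt.exists_eventuallyEq_pow_smul_nonzero_iff
      ((hf.analyticAt 0).sub analyticAt_const)).2 h1
  simp only [sub_zero, smul_eq_mul] at hfg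
  set q := dslope (fun w => p.eval w) z₀
  have hq : ∀ w, p.eval w - z₀ = (w - z₀) * q w := fun w => by
    have := sub_smul_dslope (fun w => p.eval w) z₀ w
    rw [smul_eq_mul] at this
    rw [this, hfix]
  have hqc : ContinuousAt q z₀ := continuousAt_dslope_same.2 p.differentiable.differentiableAt
  have hq0 : q z₀ = lam := by rw [← hlam]; exact dslope_same _ _
  have hmul : Tendsto (fun z : ℂ => lam * z) (𝓝 0) (𝓝 0) := by
    have : Continuous fun z : ℂ => lam * z := by fun_prop
    simpa using this.tendsto 0
  have hev : ∀ᶠ z in 𝓝[≠] (0 : ℂ), lam ^ n * g (lam * z) = g z * q (f z) := by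
    filter_upwards [mem_nhdsWithin_of_mem_nhds hfg, mem_nhdsWithin_of_mem_nhds (hmul hfg),
      self_mem_nhdsWithin] with z hz hz' hz0
    have hz0' : z ^ n ≠ 0 := pow_ne_zero _ hz0
    have hz'' : f (lam * z) - z₀ = (lam * z) ^ n * g (lam * z) := hz'
    have hz3 : f z - z₀ = z ^ n * g z := hz
    rw [hfe, hq, hz3, mul_pow] at hz''
    apply mul_left_cancel₀ hz0'
    linear_combination -hz''
  have hL : Tendsto (fun z => lam ^ n * g (lam * z)) (𝓝[≠] 0) (𝓝 (lam ^ n * g 0)) :=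
    ((hg.continuousAt.tendsto.comp hmul).const_mul _).mono_left nhdsWithin_le_nhds
  have hR : Tendsto (fun z => g z * q (f z)) (𝓝[≠] 0) (𝓝 (g 0 * lam)) := by
    refine Tendsto.mono_left ?_ nhdsWithin_le_nhds
    refine hg.continuousAt.tendsto.mul ?_
    have h3 : Tendsto f (𝓝 0) (𝓝 z₀) := hf0 ▸ hf.continuous.tendsto 0
    have h4 := hqc.tendsto.comp h3
    rwa [hq0] at h4
  have h5 := tendsto_nhds_unique hL (hR.congr' (hev.mono fun z hz => hz.symm))
  have h6 : lam ^ n = lam ^ 1 := mul_right_cancel₀ hg0 (by rw [h5]; ring)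
  have h7 : n = 1 := by
    have h8 := congrArg norm h6
    rw [norm_pow, norm_pow] at h8
    exact pow_right_injective₀ (by linarith) hlam1.ne' h8
  subst h7
  have h9 : HasDerivAt (fun z => z₀ + z ^ 1 * g z) (g 0) 0 := by
    have := (((hasDerivAt_id (0 : ℂ)).mul hg.differentiableAt.hasDerivAt).const_add z₀)
    simpa using this
  rw [(h9.congr_of_eventuallyEq (hfg.mono fun z hz => by
    have hz3 : f z - z₀ = z ^ 1 * g z := hz
    linear_combination hz3)).deriv]
  exact hg0

/-- `f` is a nondegenerate linearizing (Poincaré) function of `p` with multiplier `lam`. -/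
structure IsLinearizing (p : Polynomial ℂ) (lam : ℂ) (f : ℂ → ℂ) : Prop where
  one_lt : 1 < ‖lam‖
  differentiable : Differentiable ℂ f
  map_mul : ∀ z, f (lam * z) = p.eval (f z)
  deriv_ne_zero : deriv f 0 ≠ 0

namespace IsLinearizing

variable {p : Polynomial ℂ} {lam : ℂ} {f : ℂ → ℂ} {R : ℝ}

theorem ne_zero (H : IsLinearizing p lam f) : lam ≠ 0 :=
  norm_pos_iff.1 (zero_lt_one.trans H.one_lt)

theorem map_pow_mul (H : IsLinearizing p lam f) (n : ℕ) (z : ℂ) :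
    f (lam ^ n * z) = (fun w => p.eval w)^[n] (f z) := by
  induction n with
  | zero => simp
  | succ n ih => rw [Function.iterate_succ_apply', ← ih, ← H.map_mul, pow_succ]; ring_nf

theorem tendsto_div_pow (H : IsLinearizing p lam f) (z : ℂ) :
    Tendsto (fun n : ℕ => z / lam ^ n) atTop (𝓝 0) := by
  have h1 : Tendsto (fun n : ℕ => z * (lam⁻¹) ^ n) atTop (𝓝 (z * 0)) :=
    (tendsto_pow_atTop_nhds_zero_of_norm_lt_one (by
      rw [norm_inv]; exact inv_lt_one_of_one_lt₀ H.one_lt)).const_mul z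
  rw [mul_zero] at h1
  simpa [div_eq_mul_inv] using h1

theorem map_zero_mem_filled (H : IsLinearizing p lam f) : f 0 ∈ filledJuliaSet p := by
  have h1 : ∀ n, (fun w => p.eval w)^[n] (f 0) = f 0 := fun n => by
    rw [← H.map_pow_mul, mul_zero]
  intro ht
  simp only [h1] at ht
  exact not_tendsto_const_atTop _ _ ht

theorem exists_local_inverse (H : IsLinearizing p lam f) :
    ∃ δ > 0, ∃ k : ℂ → ℂ, (∀ w ∈ ball (f 0) δ, f (k w) = w ∧ k (p.eval w) = lam * k w ∧
      DifferentiableAt ℂ k w) ∧ k (f 0) = 0 ∧ ∀ᶠ z in 𝓝 0, k (f z) = z := by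
  obtain ⟨η, hη, hi, hder⟩ := exists_ball_injOn H.differentiable H.deriv_ne_zero
  obtain ⟨k, hk, hkd⟩ := exists_inverse_of_injOn isOpen_ball H.differentiable.differentiableOn
    hi hder
  have hl : 0 < ‖lam‖ := norm_pos_iff.2 H.ne_zero
  have hs : HasStrictDerivAt f (deriv f 0) 0 := (H.differentiable.analyticAt 0).hasStrictDerivAt
  have h1 : f '' ball 0 (η / ‖lam‖) ∈ 𝓝 (f 0) := by
    rw [← hs.map_nhds_eq H.deriv_ne_zero]
    exact image_mem_map (ball_mem_nhds _ (by positivity))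
  obtain ⟨δ, hδ, hδs⟩ := Metric.mem_nhds_iff.1 h1
  refine ⟨δ, hδ, k, fun w hw => ?_, hk 0 (mem_ball_self hη), ?_⟩
  · obtain ⟨ζ, hζ, rfl⟩ := hδs hw
    rw [mem_ball_zero_iff, lt_div_iff₀ hl] at hζ
    have h2 : ζ ∈ ball (0 : ℂ) η := by
      rw [mem_ball_zero_iff]
      nlinarith [norm_nonneg ζ, H.one_lt]
    have h3 : lam * ζ ∈ ball (0 : ℂ) η := by
      rw [mem_ball_zero_iff, norm_mul, mul_comm]
      exact hζ
    refine ⟨by rw [hk ζ h2], ?_, (hkd ζ h2).differentiableAt⟩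
    rw [← H.map_mul, hk _ h3, hk _ h2]
  · filter_upwards [ball_mem_nhds 0 hη] with z hz using hk z hz

/-- The backward orbit of lifts of the exponential function through `p`. -/
theorem exists_lifts (H : IsLinearizing p lam f) (h : IsEscapeRadius p R) (hd : 2 ≤ p.natDegree)
    (hJ : IsConnected (juliaSet (fun w => p.eval w))) {z ξ : ℂ}
    (hz : Complex.exp ξ = f z) (hξ : Real.log R < ξ.re) :
    ∃ A : ℕ → ℂ → ℂ, (∀ n, DifferentiableOn ℂ (A n) (ball ξ (ξ.re - Real.log R))) ∧
      (∀ n, ∀ x ∈ ball ξ (ξ.re - Real.log R), p.eval (A (n + 1) x) = A n x) ∧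
      (∀ n, ∀ x ∈ ball ξ (ξ.re - Real.log R),
        (fun w => p.eval w)^[n] (A n x) = Complex.exp x) ∧
      (∀ n, ∀ x ∈ ball ξ (ξ.re - Real.log R), A n x ∈ escapeDomain p R n) ∧
      ∀ n, A n ξ = f (z / lam ^ n) := by
  set B := ball ξ (ξ.re - Real.log R) with hB
  have hR : 0 < R := zero_lt_one.trans_le h.one_le
  have hl := H.ne_zero
  have hexp : ∀ x ∈ B, R < ‖Complex.exp x‖ := by
    intro x hx
    rw [Complex.norm_exp, ← Real.log_lt_iff_lt_exp hR]
    rw [hB, mem_ball, dist_comm, dist_eq_norm] at hx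
    have := (Complex.re_le_norm (ξ - x)).trans_lt hx
    rw [Complex.sub_re] at this
    linarith
  let Q : ℕ → (ℂ → ℂ) → Prop := fun n A => DifferentiableOn ℂ A B ∧
    (∀ x ∈ B, (fun w => p.eval w)^[n] (A x) = Complex.exp x) ∧ A ξ = f (z / lam ^ n)
  have hQU : ∀ n A, Q n A → ∀ x ∈ B, A x ∈ escapeDomain p R n := by
    intro n A hA x hx
    change R < ‖(fun w => p.eval w)^[n] (A x)‖
    rw [hA.2.1 x hx]
    exact hexp x hx
  have hstep : ∀ n A, Q n A → ∃ A', Q (n + 1) A' ∧ ∀ x ∈ B, p.eval (A' x) = A x := by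
    intro n A hA
    obtain ⟨A', h1, h2, h3⟩ := h.exists_lift hd hJ n (a := f (z / lam ^ (n + 1)))
      (sub_pos.2 hξ) hA.1 (hQU n A hA) (by
        rw [hA.2.2, ← H.map_mul]
        congr 1
        field_simp
        ring)
    refine ⟨A', ⟨h1, fun x hx => ?_, h3⟩, h2⟩
    rw [Function.iterate_succ_apply, h2 x hx]
    exact hA.2.1 x hx
  choose! F hF1 hF2 using hstep
  let A : ℕ → ℂ → ℂ := fun n => Nat.rec Complex.exp (fun n A => F n A) n
  have hA : ∀ n, Q n (A n) := by
    intro n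
    induction n with
    | zero =>
      exact ⟨Complex.differentiable_exp.differentiableOn, fun x _ => rfl, by rw [pow_zero, div_one]; exact hz⟩
    | succ n ih => exact hF1 n (A n) ih
  exact ⟨A, fun n => (hA n).1, fun n => hF2 n (A n) (hA n), fun n => (hA n).2.1,
    fun n => hQU n (A n) (hA n), fun n => (hA n).2.2⟩

/-- A branch of `f⁻¹ ∘ exp` with prescribed value at the centre of a disc. -/
theorem exists_pullback (H : IsLinearizing p lam f) (h : IsEscapeRadius p R)
    (hd : 2 ≤ p.natDegree) (hJ : IsConnected (juliaSet (fun w => p.eval w))) {z ξ : ℂ}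
    (hz : Complex.exp ξ = f z) (hξ : Real.log R < ξ.re) :
    ∃ G : ℂ → ℂ, DifferentiableOn ℂ G (ball ξ (ξ.re - Real.log R)) ∧
      (∀ x ∈ ball ξ (ξ.re - Real.log R), f (G x) = Complex.exp x) ∧ G ξ = z := by
  obtain ⟨A, hAd, hAs, hAe, hAU, hAξ⟩ := H.exists_lifts h hd hJ hz hξ
  obtain ⟨δ, hδ, k, hk, hk0, hkf⟩ := H.exists_local_inverse
  set ρ := ξ.re - Real.log R with hρ
  have hρ0 : 0 < ρ := sub_pos.2 hξ
  have hl := H.ne_zero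
  set M := max R (Real.exp (ξ.re + ρ))
  have hR : 0 < R := zero_lt_one.trans_le h.one_le
  have hM0 : 0 < M := lt_max_of_lt_left hR
  have hM : ∀ n, ∀ x ∈ ball ξ ρ, ‖A n x‖ ≤ M := by
    intro n x hx
    rcases le_total R ‖A n x‖ with h1 | h1
    · have h2 := h.pow_mul_le h1 n
      rw [hAe n x hx, Complex.norm_exp] at h2
      have h3 : (1 : ℝ) ≤ 2 ^ n := one_le_pow₀ (by norm_num)
      have h4 : x.re ≤ ξ.re + ρ := by
        rw [mem_ball, dist_eq_norm] at hx
        have := (Complex.re_le_norm (x - ξ)).trans_lt hx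
        rw [Complex.sub_re] at this
        linarith
      have h5 := Real.exp_le_exp.2 h4
      exact le_max_of_le_right (by nlinarith [norm_nonneg (A n x)])
    · exact le_max_of_le_left h1
  have hlip : ∀ x r, 0 < r → ball x r ⊆ ball ξ ρ → ∀ n, ∀ y ∈ ball x r,
      dist (A n y) (A n x) ≤ 2 * M / r * dist y x := by
    intro x r hr hsub n y hy
    refine Complex.dist_le_div_mul_dist_of_mapsTo_ball ((hAd n).mono hsub) (fun w hw => ?_) hy
    rw [mem_closedBall, dist_eq_norm]
    have h1 := hM n w (hsub hw)
    have h2 := hM n x (hsub (mem_ball_self hr))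
    linarith [norm_sub_le (A n w) (A n x)]
  set S := {x ∈ ball ξ ρ | Tendsto (fun n => A n x) atTop (𝓝 (f 0))} with hS
  have hloc : ∀ x ∈ S, ∃ r > 0, ball x r ⊆ ball ξ ρ ∧ ∃ N, ∀ y ∈ ball x r, ∀ n, N ≤ n →
      A n y ∈ ball (f 0) δ := by
    rintro x ⟨hxB, hx⟩
    obtain ⟨r, hr, hsub⟩ := Metric.isOpen_ball.mem_nhds hxB |> Metric.mem_nhds_iff.1
    obtain ⟨N, hN⟩ := eventually_atTop.1 (hx.eventually (ball_mem_nhds _ (half_pos hδ)))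
    refine ⟨min r (δ / 2 * r / (2 * M)), by positivity,
      (ball_subset_ball (min_le_left _ _)).trans hsub, N, fun y hy n hn => ?_⟩
    have h1 := hlip x r hr hsub n y (ball_subset_ball (min_le_left _ _) hy)
    have h2 : dist y x < δ / 2 * r / (2 * M) := (mem_ball.1 hy).trans_le (min_le_right _ _)
    have h3 : 2 * M / r * dist y x < δ / 2 := by
      rw [lt_div_iff₀ (by positivity)] at h2
      rw [div_mul_eq_mul_div, div_lt_iff₀ hr]
      linarith
    have h4 : dist (A n x) (f 0) < δ / 2 := hN n hn
    rw [mem_ball]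
    linarith [dist_triangle (A n y) (A n x) (f 0)]
  have hpow : ∀ y ∈ ball ξ ρ, ∀ N, (∀ n, N ≤ n → A n y ∈ ball (f 0) δ) → ∀ n, N ≤ n →
      lam ^ n * k (A n y) = lam ^ N * k (A N y) := by
    intro y hy N hN n hn
    induction n, hn using Nat.le_induction with
    | base => rfl
    | succ n hn ih =>
      rw [← ih, ← hAs n y hy, (hk _ (hN (n + 1) (by omega))).2.1, pow_succ]
      ring
  have hSopen : IsOpen S := by
    rw [Metric.isOpen_iff]
    intro x hx
    obtain ⟨r, hr, hsub, N, hN⟩ := hloc x hx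
    refine ⟨r, hr, fun y hy => ⟨hsub hy, ?_⟩⟩
    have h1 : ∀ n, N ≤ n → f ((lam ^ N * k (A N y)) / lam ^ n) = A n y := by
      intro n hn
      rw [← hpow y (hsub hy) N (hN y hy) n hn, mul_div_cancel_left₀ _ (pow_ne_zero _ hl)]
      exact (hk _ (hN y hy n hn)).1
    refine ((H.differentiable.continuous.tendsto 0).comp
      (H.tendsto_div_pow (lam ^ N * k (A N y)))).congr' ?_
    filter_upwards [eventually_ge_atTop N] with n hn using h1 n hn
  have hSall : ball ξ ρ ⊆ S := by
    refine (convex_ball ξ ρ).isPreconnected.subset_of_closure_inter_subset hSopen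
      ⟨ξ, mem_ball_self hρ0, mem_ball_self hρ0, ?_⟩ ?_
    · simp only [hAξ]
      exact (H.differentiable.continuous.tendsto 0).comp (H.tendsto_div_pow z)
    · rintro x ⟨hxcl, hxB⟩
      refine ⟨hxB, ?_⟩
      obtain ⟨r, hr, hsub⟩ := Metric.isOpen_ball.mem_nhds hxB |> Metric.mem_nhds_iff.1
      rw [Metric.tendsto_atTop]
      intro ε hε
      obtain ⟨y, hyS, hxy⟩ := Metric.mem_closure_iff.1 hxcl (min r (ε / 2 * r / (2 * M)))
        (by positivity)
      rw [dist_comm] at hxy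
      obtain ⟨N, hN⟩ := Metric.tendsto_atTop.1 hyS.2 (ε / 2) (half_pos hε)
      refine ⟨N, fun n hn => ?_⟩
      have h1 := hlip x r hr hsub n y (mem_ball.2 (hxy.trans_le (min_le_left _ _)))
      have h2 : dist y x < ε / 2 * r / (2 * M) := hxy.trans_le (min_le_right _ _)
      have h3 : 2 * M / r * dist y x < ε / 2 := by
        rw [lt_div_iff₀ (by positivity)] at h2
        rw [div_mul_eq_mul_div, div_lt_iff₀ hr]
        linarith
      have h4 := hN n hn
      rw [dist_comm] at h1
      linarith [dist_triangle (A n x) (A n y) (f 0)]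
  let G : ℂ → ℂ := fun x => limUnder atTop fun n => lam ^ n * k (A n x)
  have hG : ∀ y ∈ ball ξ ρ, ∀ N, (∀ n, N ≤ n → A n y ∈ ball (f 0) δ) →
      G y = lam ^ N * k (A N y) := by
    intro y hy N hN
    refine Tendsto.limUnder_eq (tendsto_const_nhds.congr' ?_)
    filter_upwards [eventually_ge_atTop N] with n hn using (hpow y hy N hN n hn).symm
  refine ⟨G, fun x hx => ?_, fun x hx => ?_, ?_⟩
  · obtain ⟨r, hr, hsub, N, hN⟩ := hloc x (hSall hx)
    have h1 : DifferentiableAt ℂ (A N) x := (hAd N).differentiableAt (isOpen_ball.mem_nhds hx)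
    have h2 : DifferentiableAt ℂ k (A N x) := (hk _ (hN x (mem_ball_self hr) N le_rfl)).2.2
    have h3 : DifferentiableAt ℂ (fun y => lam ^ N * k (A N y)) x :=
      (h2.comp x h1).const_mul _
    refine (h3.congr_of_eventuallyEq ?_).differentiableWithinAt
    filter_upwards [ball_mem_nhds x hr] with y hy
    exact hG y (hsub hy) N (hN y hy)
  · obtain ⟨r, hr, hsub, N, hN⟩ := hloc x (hSall hx)
    have hx' := hN x (mem_ball_self hr)
    rw [hG x hx N hx', H.map_pow_mul, (hk _ (hx' N le_rfl)).1, hAe N x hx]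
  · refine Tendsto.limUnder_eq (tendsto_const_nhds.congr' ?_)
    filter_upwards [(H.tendsto_div_pow z).eventually hkf] with n hn
    rw [hAξ, hn, mul_div_cancel₀ _ (pow_ne_zero _ hl)]

end IsLinearizing

/-- The preimage of the filled Julia set under `f ∘ exp`. -/
def logPreimage (p : Polynomial ℂ) (f : ℂ → ℂ) : Set ℂ :=
  {x | f (Complex.exp x) ∈ filledJuliaSet p}

namespace IsLinearizing

variable {p : Polynomial ℂ} {lam : ℂ} {f : ℂ → ℂ} {R : ℝ}

theorem isClosed_logPreimage (H : IsLinearizing p lam f) (h : IsEscapeRadius p R) :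
    IsClosed (logPreimage p f) :=
  h.isCompact_filled.isClosed.preimage (H.differentiable.continuous.comp Complex.continuous_exp)

theorem exists_log_pullback (H : IsLinearizing p lam f) (h : IsEscapeRadius p R)
    (hd : 2 ≤ p.natDegree) (hJ : IsConnected (juliaSet (fun w => p.eval w))) {ζ ξ : ℂ}
    (hz : Complex.exp ξ = f (Complex.exp ζ)) (hξ : Real.log R < ξ.re) :
    ∃ g : ℂ → ℂ, DifferentiableOn ℂ g (ball ξ (ξ.re - Real.log R)) ∧
      (∀ x ∈ ball ξ (ξ.re - Real.log R), f (Complex.exp (g x)) = Complex.exp x) ∧ g ξ = ζ ∧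
      ∀ x ∈ ball ξ (ξ.re - Real.log R), g x ∉ logPreimage p f := by
  obtain ⟨G, hG, hGe, hGξ⟩ := H.exists_pullback h hd hJ hz hξ
  have hR : 0 < R := zero_lt_one.trans_le h.one_le
  have hexp : ∀ x ∈ ball ξ (ξ.re - Real.log R), R < ‖Complex.exp x‖ := by
    intro x hx
    rw [Complex.norm_exp, ← Real.log_lt_iff_lt_exp hR]
    rw [mem_ball, dist_comm, dist_eq_norm] at hx
    have := (Complex.re_le_norm (ξ - x)).trans_lt hx
    rw [Complex.sub_re] at this
    linarith
  have hne : ∀ x ∈ ball ξ (ξ.re - Real.log R), G x ≠ 0 := by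
    intro x hx h0
    have h1 := hGe x hx
    rw [h0] at h1
    have h2 := h.mem_filled_iff_lt.1 H.map_zero_mem_filled 0
    rw [h1] at h2
    exact (hexp x hx).not_gt h2
  obtain ⟨L, hL, hLe⟩ := exists_log_on_ball hG hne
  have hξB : ξ ∈ ball ξ (ξ.re - Real.log R) := mem_ball_self (sub_pos.2 hξ)
  obtain ⟨n, hn⟩ := Complex.exp_eq_exp_iff_exists_int.1 ((hLe ξ hξB).trans hGξ)
  have hfe : ∀ x ∈ ball ξ (ξ.re - Real.log R),
      f (Complex.exp (L x - n * (2 * Real.pi * Complex.I))) = Complex.exp x := by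
    intro x hx
    rw [Complex.exp_sub, Complex.exp_int_mul_two_pi_mul_I, div_one, hLe x hx, hGe x hx]
  refine ⟨fun x => L x - n * (2 * Real.pi * Complex.I), hL.sub_const _, hfe, ?_,
    fun x hx hxT => ?_⟩
  · change L ξ - n * (2 * Real.pi * Complex.I) = ζ
    rw [hn, add_sub_cancel_right]
  · have h1 : f (Complex.exp (L x - n * (2 * Real.pi * Complex.I))) ∈ filledJuliaSet p := hxT
    rw [hfe x hx] at h1
    exact (h.mem_filled_iff_lt.1 h1 0).not_gt (hexp x hx)

/-- The set `logPreimage p f` is invariant under the translations of a lattice. -/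
theorem exists_translation (H : IsLinearizing p lam f) : ∃ D > 0, ∀ x y : ℂ, ∃ t : ℂ,
    ‖x + t - y‖ < D ∧ ∀ w, w + t ∈ logPreimage p f ↔ w ∈ logPreimage p f := by
  set l := Complex.log lam with hl
  have hlre : 0 < l.re := by
    rw [hl, Complex.log_re]
    exact Real.log_pos H.one_lt
  have hpi := Real.pi_pos
  have hinv1 : ∀ w, w + l ∈ logPreimage p f ↔ w ∈ logPreimage p f := by
    intro w
    change f (Complex.exp (w + l)) ∈ filledJuliaSet p ↔ f (Complex.exp w) ∈ filledJuliaSet p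
    rw [Complex.exp_add, hl, Complex.exp_log H.ne_zero, mul_comm, H.map_mul, eval_mem_filled_iff]
  have hinv2 : ∀ (k : ℤ) (w : ℂ), w + k * l ∈ logPreimage p f ↔ w ∈ logPreimage p f := by
    intro k
    induction k using Int.induction_on with
    | zero => simp
    | succ k ih =>
      intro w
      have e : w + ((k + 1 : ℤ) : ℂ) * l = w + ((k : ℤ) : ℂ) * l + l := by push_cast; ring
      rw [e, hinv1, ih]
    | pred k ih =>
      intro w
      have e : w + ((-k - 1 : ℤ) : ℂ) * l + l = w + ((-k : ℤ) : ℂ) * l := by push_cast; ring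
      rw [← hinv1, e, ih]
  have hinv3 : ∀ (m : ℤ) (w : ℂ), w + m * (2 * Real.pi * Complex.I) ∈ logPreimage p f ↔
      w ∈ logPreimage p f := by
    intro m w
    change f (Complex.exp (w + m * (2 * Real.pi * Complex.I))) ∈ filledJuliaSet p ↔
      f (Complex.exp w) ∈ filledJuliaSet p
    rw [Complex.exp_add, Complex.exp_int_mul_two_pi_mul_I, mul_one]
  refine ⟨l.re + 2 * Real.pi, by positivity, fun x y => ?_⟩
  set k : ℤ := round ((y - x).re / l.re) with hk
  set v : ℂ := y - x - k * l with hv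
  set m : ℤ := round (v.im / (2 * Real.pi)) with hm
  refine ⟨k * l + m * (2 * Real.pi * Complex.I), ?_, fun w => by
    rw [← add_assoc, hinv3, hinv2]⟩
  have h1 : |v.re| ≤ l.re / 2 := by
    have h2 := abs_sub_round ((y - x).re / l.re)
    have h3 : v.re = ((y - x).re / l.re - k) * l.re := by
      rw [sub_mul, div_mul_cancel₀ _ hlre.ne', hv]
      simp
    rw [h3, abs_mul, abs_of_pos hlre]
    nlinarith
  have h2 : |(v - m * (2 * Real.pi * Complex.I)).im| ≤ Real.pi := by
    have h2 := abs_sub_round (v.im / (2 * Real.pi))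
    have h3 : (v - m * (2 * Real.pi * Complex.I)).im = (v.im / (2 * Real.pi) - m) * (2 * Real.pi) := by
      rw [sub_mul, div_mul_cancel₀ _ (by positivity)]
      simp
    rw [h3, abs_mul, abs_of_pos (show 0 < 2 * Real.pi by positivity)]
    nlinarith
  have h3 : (v - m * (2 * Real.pi * Complex.I)).re = v.re := by simp
  have h4 : x + (k * l + m * (2 * Real.pi * Complex.I)) - y = -(v - m * (2 * Real.pi * Complex.I)) := by
    rw [hv]; ring
  rw [h4, norm_neg]
  refine (Complex.norm_le_abs_re_add_abs_im _).trans_lt ?_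
  rw [h3]
  linarith

theorem volume_logPreimage_pos (H : IsLinearizing p lam f)
    (hK : 0 < volume (filledJuliaSet p)) : volume (logPreimage p f) ≠ 0 := by
  intro h0
  obtain ⟨a, ha⟩ : ∃ a, ∀ w, w ≠ a → ∃ z, f z = w := by
    by_contra hcon
    push Not at hcon
    obtain ⟨a, -, ha⟩ := hcon 0
    obtain ⟨b, hba, hb⟩ := hcon a
    exact H.deriv_ne_zero (deriv_eq_zero_of_omits H.differentiable hba hb ha 0)
  have h1 : volume ((fun x => f (Complex.exp x)) '' logPreimage p f) = 0 :=
    addHaar_image_eq_zero_of_differentiableOn_of_addHaar_eq_zero volume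
      ((H.differentiable.comp Complex.differentiable_exp).restrictScalars ℝ).differentiableOn h0
  have h2 : filledJuliaSet p ⊆
      (fun x => f (Complex.exp x)) '' logPreimage p f ∪ {a, f 0} := by
    intro w hw
    by_cases hwa : w = a
    · exact Or.inr (Or.inl hwa)
    by_cases hw0 : w = f 0
    · exact Or.inr (Or.inr hw0)
    obtain ⟨z, hz⟩ := ha w hwa
    have hz0 : z ≠ 0 := by
      rintro rfl
      exact hw0 hz.symm
    have hexp : f (Complex.exp (Complex.log z)) = w := by rw [Complex.exp_log hz0, hz]
    exact Or.inl ⟨Complex.log z, show f _ ∈ filledJuliaSet p by rwa [hexp], hexp⟩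
  have h3 : volume ((fun x => f (Complex.exp x)) '' logPreimage p f ∪ {a, f 0}) = 0 :=
    measure_union_null h1 ((Set.toFinite _).measure_zero _)
  exact hK.ne' (measure_mono_null h2 h3)

theorem exists_volume_lower_bound (H : IsLinearizing p lam f)
    (hK : 0 < volume (filledJuliaSet p)) :
    ∃ C > 0, ∃ c > 0, ∀ y, ∃ y' : ℂ, ball y' 1 ⊆ ball y C ∧
      c ≤ volume (logPreimage p f ∩ ball y' 1) := by
  obtain ⟨D, hD, htr⟩ := H.exists_translation
  obtain ⟨x, -, hx⟩ := exists_mem_forall_mem_nhdsWithin_pos_measure (H.volume_logPreimage_pos hK)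
  refine ⟨D + 1, by positivity, volume (logPreimage p f ∩ ball x 1), hx _
    (inter_mem self_mem_nhdsWithin (mem_nhdsWithin_of_mem_nhds (ball_mem_nhds x one_pos))),
    fun y => ?_⟩
  obtain ⟨t, ht, hinv⟩ := htr x y
  refine ⟨x + t, ball_subset_ball' ?_, ?_⟩
  · rw [dist_eq_norm]
    linarith
  rw [← measure_preimage_add_right volume (-t)]
  refine measure_mono fun w hw => ?_
  have hw1 : w + -t ∈ logPreimage p f := hw.1
  have hw2 : w + -t ∈ ball x 1 := hw.2
  refine ⟨by rw [← hinv, neg_add_cancel_right] at hw1; exact hw1, ?_⟩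
  rw [mem_ball, dist_eq_norm] at hw2 ⊢
  have h1 : w - (x + t) = w + -t - x := by ring
  rwa [h1]

/-- Holomorphic maps omitting `logPreimage p f` have small derivatives on large discs. -/
theorem exists_deriv_bound (H : IsLinearizing p lam f) (hne : (logPreimage p f).Nonempty) :
    ∃ C > 0, ∀ (g : ℂ → ℂ) (c : ℂ) (r : ℝ), 0 < r → DifferentiableOn ℂ g (ball c r) →
      (∀ x ∈ ball c r, g x ∉ logPreimage p f) → ‖deriv g c‖ * r ≤ C := by
  obtain ⟨D, hD, htr⟩ := H.exists_translation
  obtain ⟨x, hx⟩ := hne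
  refine ⟨128 * D, by positivity, fun g c r hr hg hom => ?_⟩
  refine norm_deriv_mul_radius_le_of_omits hr hD.le hg fun y => ?_
  obtain ⟨t, ht, hinv⟩ := htr x y
  refine ⟨x + t, by rwa [mem_ball, dist_eq_norm], ?_⟩
  rintro ⟨w, hw, hwx⟩
  apply hom w hw
  rw [hwx, hinv]
  exact hx

end IsLinearizing

/-- A set has measure zero if each of its points is the centre of arbitrarily small discs in which
its complement takes up a definite proportion. -/
theorem volume_eq_zero_of_density {E : Set ℂ} (hE : MeasurableSet E) {κ : ℝ≥0∞} (hκ : κ ≠ 0)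
    (h : ∀ z ∈ E, ∃ s : ℕ → ℝ, (∀ n, 0 < s n) ∧ Tendsto s atTop (𝓝 0) ∧
      ∀ n, volume (E ∩ closedBall z (s n)) + κ * volume (closedBall z (s n)) ≤
        volume (closedBall z (s n))) : volume E = 0 := by
  rw [measure_eq_zero_iff_ae_notMem]
  filter_upwards [(ae_restrict_iff' hE).1 (Besicovitch.ae_tendsto_measure_inter_div volume E)]
    with z hz hzE
  obtain ⟨s, hs0, hs, hle⟩ := h z hzE
  have h1 : Tendsto s atTop (𝓝[>] 0) :=
    tendsto_nhdsWithin_iff.2 ⟨hs, Eventually.of_forall hs0⟩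
  have h2 := ((hz hzE).comp h1).add_const κ
  have h3 : 1 + κ ≤ 1 := by
    refine le_of_tendsto h2 (Eventually.of_forall fun n => ?_)
    have hV0 : volume (closedBall z (s n)) ≠ 0 := (measure_closedBall_pos _ _ (hs0 n)).ne'
    have hVt : volume (closedBall z (s n)) ≠ ∞ := measure_closedBall_lt_top.ne
    have h4 := ENNReal.div_le_div_right (hle n) (volume (closedBall z (s n)))
    rw [ENNReal.add_div, ENNReal.mul_div_cancel_right hV0 hVt, ENNReal.div_self hV0 hVt] at h4
    exact h4
  exact h3.not_gt (ENNReal.lt_add_right one_ne_top hκ)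

namespace IsLinearizing

variable {p : Polynomial ℂ} {lam : ℂ} {f : ℂ → ℂ} {R : ℝ}

/-- Logarithmic inverse branches contract discs of fixed size far to the right. -/
theorem exists_contraction (H : IsLinearizing p lam f) (h : IsEscapeRadius p R)
    (hd : 2 ≤ p.natDegree) (hJ : IsConnected (juliaSet (fun w => p.eval w)))
    (hne : (logPreimage p f).Nonempty) {r : ℝ} (hr : 0 < r) :
    ∃ R₁, R ≤ R₁ ∧ ∀ ζ ξ : ℂ, Complex.exp ξ = f (Complex.exp ζ) → Real.log R₁ ≤ ξ.re →
      ∃ g : ℂ → ℂ, DifferentiableOn ℂ g (ball ξ r) ∧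
        (∀ x ∈ ball ξ r, f (Complex.exp (g x)) = Complex.exp x) ∧ g ξ = ζ ∧
        MapsTo g (ball ξ r) (ball ζ r) ∧ ‖deriv g ξ‖ ≤ 1 / 2 := by
  obtain ⟨C, hC, hbound⟩ := H.exists_deriv_bound hne
  have hR : 0 < R := zero_lt_one.trans_le h.one_le
  refine ⟨R * Real.exp (r + 2 * C), le_mul_of_one_le_right hR.le
    (Real.one_le_exp (by positivity)), fun ζ ξ hz hξ => ?_⟩
  rw [Real.log_mul hR.ne' (Real.exp_pos _).ne', Real.log_exp] at hξ
  obtain ⟨g, hg, hge, hgξ, hgT⟩ := H.exists_log_pullback h hd hJ hz (by linarith)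
  have hsub : ball ξ r ⊆ ball ξ (ξ.re - Real.log R) := ball_subset_ball (by linarith)
  have hder : ∀ x ∈ ball ξ r, ‖deriv g x‖ ≤ 1 / 2 := by
    intro x hx
    have hs : ball x (2 * C) ⊆ ball ξ (ξ.re - Real.log R) :=
      ball_subset_ball' (by rw [mem_ball] at hx; linarith)
    have := hbound g x (2 * C) (by positivity) (hg.mono hs) fun y hy => hgT y (hs hy)
    nlinarith
  refine ⟨g, hg.mono hsub, fun x hx => hge x (hsub hx), hgξ, fun x hx => ?_,
    hder ξ (mem_ball_self hr)⟩
  have h1 := (convex_ball ξ r).norm_image_sub_le_of_norm_deriv_le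
    (fun y hy => hg.differentiableAt (isOpen_ball.mem_nhds (hsub hy))) hder (mem_ball_self hr) hx
  rw [mem_ball, dist_eq_norm] at hx ⊢
  rw [hgξ] at h1
  linarith [norm_nonneg (x - ξ)]

/-- Iterated logarithmic inverse branches along an orbit staying far from the origin. -/
theorem exists_iterated_branch {r R₁ : ℝ} (hr : 0 < r) (hR₁ : 0 < R₁)
    (hcontr : ∀ ζ ξ : ℂ, Complex.exp ξ = f (Complex.exp ζ) → Real.log R₁ ≤ ξ.re →
      ∃ g : ℂ → ℂ, DifferentiableOn ℂ g (ball ξ r) ∧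
        (∀ x ∈ ball ξ r, f (Complex.exp (g x)) = Complex.exp x) ∧ g ξ = ζ ∧
        MapsTo g (ball ξ r) (ball ζ r) ∧ ‖deriv g ξ‖ ≤ 1 / 2)
    {z : ℂ} (hz : ∀ n, R₁ ≤ ‖f^[n] z‖) (n : ℕ) :
    ∃ Θ : ℂ → ℂ, DifferentiableOn ℂ Θ (ball (Complex.log (f^[n] z)) r) ∧
      (∀ x ∈ ball (Complex.log (f^[n] z)) r, f^[n] (Complex.exp (Θ x)) = Complex.exp x) ∧
      Θ (Complex.log (f^[n] z)) = Complex.log z ∧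
      ‖deriv Θ (Complex.log (f^[n] z))‖ ≤ (1 / 2) ^ n := by
  have hexp : ∀ n, Complex.exp (Complex.log (f^[n] z)) = f^[n] z := fun n =>
    Complex.exp_log (norm_pos_iff.1 (hR₁.trans_le (hz n)))
  induction n with
  | zero => exact ⟨id, differentiableOn_id, fun x _ => rfl, rfl, by simp⟩
  | succ n ih =>
    obtain ⟨Θ, hΘ, hΘe, hΘz, hΘd⟩ := ih
    obtain ⟨g, hg, hge, hgξ, hgm, hgd⟩ := hcontr (Complex.log (f^[n] z))
      (Complex.log (f^[n + 1] z)) (by rw [hexp, hexp, Function.iterate_succ_apply']) (by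
        rw [Complex.log_re]
        exact Real.log_le_log hR₁ (hz _))
    refine ⟨Θ ∘ g, hΘ.comp hg hgm, fun x hx => ?_, ?_, ?_⟩
    · rw [Function.iterate_succ_apply', Function.comp_apply, hΘe _ (hgm hx), hge x hx]
    · rw [Function.comp_apply, hgξ, hΘz]
    · have h1 : DifferentiableAt ℂ Θ (g (Complex.log (f^[n + 1] z))) := by
        rw [hgξ]
        exact hΘ.differentiableAt (ball_mem_nhds _ hr)
      rw [deriv_comp _ h1 (hg.differentiableAt (ball_mem_nhds _ hr)), hgξ, norm_mul, pow_succ]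
      gcongr

theorem volume_bounded_below_orbits (H : IsLinearizing p lam f) (h : IsEscapeRadius p R)
    (hd : 2 ≤ p.natDegree) (hJ : IsConnected (juliaSet (fun w => p.eval w)))
    (hK : 0 < volume (filledJuliaSet p)) :
    ∃ R₁ : ℝ, volume {z | ∀ n, R₁ ≤ ‖f^[n] z‖} = 0 := by
  obtain ⟨B, hB, c, hc, hlow⟩ := H.exists_volume_lower_bound hK
  obtain ⟨C, hC, hdist⟩ := exists_distortion_bound hB
  obtain ⟨R₁, hRR, hcontr⟩ := H.exists_contraction h hd hJ
    (nonempty_of_measure_ne_zero (H.volume_logPreimage_pos hK)) (r := B + 3) (by positivity)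
  have hR : 0 < R := zero_lt_one.trans_le h.one_le
  have hR₁ : 0 < R₁ := hR.trans_le hRR
  refine ⟨R₁, ?_⟩
  set E := {z | ∀ n, R₁ ≤ ‖f^[n] z‖} with hEdef
  have hfc : ∀ n, Continuous (f^[n]) := fun n => H.differentiable.continuous.iterate n
  have hE : MeasurableSet E := by
    have h1 : E = ⋂ n, {z | R₁ ≤ ‖f^[n] z‖} := by
      ext z
      simp [hEdef]
    rw [h1]
    exact (isClosed_iInter fun n => isClosed_le continuous_const (hfc n).norm).measurableSet
  have hpi0 : (NNReal.pi : ℝ≥0∞) ≠ 0 := by simp [NNReal.pi_ne_zero]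
  set κ : ℝ≥0∞ := ENNReal.ofReal (((C ^ 2 * B)⁻¹) ^ 2) * c / NNReal.pi with hκ
  have hκ0 : κ ≠ 0 := by
    refine (ENNReal.div_pos (mul_ne_zero ?_ hc.ne') coe_ne_top).ne'
    rw [Ne, ENNReal.ofReal_eq_zero, not_le]
    positivity
  refine volume_eq_zero_of_density hE hκ0 fun z hz => ?_
  have hz0 : z ≠ 0 := norm_pos_iff.1 (hR₁.trans_le (hz 0))
  have key : ∀ n : ℕ, ∃ s : ℝ, 0 < s ∧ s ≤ C * B * ‖z‖ * (1 / 2) ^ n ∧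
      volume (E ∩ closedBall z s) + κ * volume (closedBall z s) ≤ volume (closedBall z s) := by
    intro n
    obtain ⟨Θ, hΘ, hΘe, hΘz, hΘd⟩ := exists_iterated_branch (by positivity) hR₁ hcontr hz n
    set ξ := Complex.log (f^[n] z)
    set g : ℂ → ℂ := fun x => Complex.exp (Θ x) with hgdef
    have hg : DifferentiableOn ℂ g (ball ξ (B + 3)) := hΘ.cexp
    have hgd : ∀ x ∈ ball ξ (B + 3), DifferentiableAt ℂ g x := fun x hx =>
      hg.differentiableAt (isOpen_ball.mem_nhds hx)
    have hgz : g ξ = z := by simp only [hgdef]; rw [hΘz, Complex.exp_log hz0]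
    have hξ : ξ ∈ ball ξ (B + 3) := mem_ball_self (by positivity)
    have hg0 : ∀ x ∈ ball ξ (B + 3), deriv g x ≠ 0 := by
      intro x hx h0
      have h1 : HasDerivAt (fun y => f^[n] (g y)) (deriv (f^[n]) (g x) * deriv g x) x :=
        ((H.differentiable.iterate n) (g x)).hasDerivAt.comp x (hgd x hx).hasDerivAt
      have h2 : HasDerivAt (fun y => f^[n] (g y)) (Complex.exp x) x := by
        refine (Complex.hasDerivAt_exp x).congr_of_eventuallyEq ?_
        filter_upwards [isOpen_ball.mem_nhds hx] with y hy using hΘe y hy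
      have h3 := h1.unique h2
      rw [h0, mul_zero] at h3
      exact Complex.exp_ne_zero x h3.symm
    have hinj : ∀ x ∈ ball ξ B, InjOn g (ball x 3) := by
      intro x hx y hy y' hy' hyy
      have hsub : ball x 3 ⊆ ball ξ (B + 3) :=
        ball_subset_ball' (by rw [mem_ball] at hx; linarith)
      have h1 : Complex.exp y = Complex.exp y' := by
        rw [← hΘe y (hsub hy), ← hΘe y' (hsub hy')]
        exact congrArg _ hyy
      obtain ⟨k, hk⟩ := Complex.exp_eq_exp_iff_exists_int.1 h1
      have h2 : dist y y' < 6 := by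
        rw [mem_ball] at hy hy'
        linarith [dist_triangle_right y y' x]
      rw [dist_eq_norm, hk, add_sub_cancel_left, norm_mul, norm_mul, norm_mul, Complex.norm_I,
        Complex.norm_real, Complex.norm_intCast, Real.norm_of_nonneg Real.pi_pos.le] at h2
      have h3 : |(k : ℝ)| < 1 := by
        norm_num at h2
        nlinarith [Real.pi_gt_three, abs_nonneg (k : ℝ)]
      have h4 : k = 0 := by
        have : |k| < 1 := by exact_mod_cast h3
        exact Int.abs_lt_one_iff.1 this
      rw [hk, h4]
      simp
    have hD := hdist g ξ hg hg0 hinj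
    set ε := ‖deriv g ξ‖ with hε
    have hε0 : 0 < ε := norm_pos_iff.2 (hg0 ξ hξ)
    have hεle : ε ≤ ‖z‖ * (1 / 2) ^ n := by
      have h1 : deriv g ξ = Complex.exp (Θ ξ) * deriv Θ ξ :=
        (hΘ.differentiableAt (isOpen_ball.mem_nhds hξ)).hasDerivAt.cexp.deriv
      rw [hε, h1, hΘz, Complex.exp_log hz0, norm_mul]
      gcongr
    have hBsub : ball ξ B ⊆ ball ξ (B + 3) := ball_subset_ball (by linarith)
    obtain ⟨y, hysub, hyc⟩ := hlow ξ
    set Q := logPreimage p f ∩ ball y 1 with hQ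
    have hQm : MeasurableSet Q :=
      (H.isClosed_logPreimage h).measurableSet.inter measurableSet_ball
    have hQB : Q ⊆ ball ξ B := fun x hx => hysub hx.2
    have hyB : y ∈ ball ξ B := hysub (mem_ball_self one_pos)
    have hQi : InjOn g Q := (hinj y hyB).mono fun x hx => ball_subset_ball (by norm_num) hx.2
    have harea := mul_volume_le_volume_image isOpen_ball hg (hQB.trans hBsub) hQm hQi
      (m := ε / C) (by positivity) fun x hx => by
        rw [div_le_iff₀' hC]
        exact (hD x (hQB hx)).2
    refine ⟨C * B * ε, by positivity, ?_, ?_⟩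
    · have := mul_le_mul_of_nonneg_left hεle (show 0 ≤ C * B by positivity)
      linarith
    set s := C * B * ε with hs
    have himg : g '' Q ⊆ closedBall z s \ E := by
      rintro _ ⟨x, hx, rfl⟩
      constructor
      · have h1 := (convex_ball ξ B).norm_image_sub_le_of_norm_deriv_le
          (fun w hw => hgd w (hBsub hw)) (fun w hw => (hD w hw).1) (mem_ball_self hB) (hQB hx)
        rw [hgz] at h1
        rw [mem_closedBall, dist_eq_norm]
        have h2 : ‖x - ξ‖ ≤ B := by
          rw [← dist_eq_norm]
          exact (mem_ball.1 (hQB hx)).le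
        refine h1.trans ?_
        rw [hs]
        have := mul_le_mul_of_nonneg_left h2 (show 0 ≤ C * ε by positivity)
        linarith
      · intro hxE
        have h1 := hxE (n + 1)
        have h2 : f (Complex.exp x) ∈ filledJuliaSet p := hx.1
        rw [Function.iterate_succ_apply', hΘe x (hBsub (hQB hx))] at h1
        have h3 := h.mem_filled_iff_lt.1 h2 0
        rw [Function.iterate_zero_apply] at h3
        linarith
    have hκV : κ * volume (closedBall z s) ≤ volume (closedBall z s \ E) := by
      refine le_trans ?_ (harea.trans (measure_mono himg))
      have h1 : κ * volume (closedBall z s) = ENNReal.ofReal ((ε / C) ^ 2) * c := by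
        rw [Complex.volume_closedBall, hκ, ← ENNReal.ofReal_pow (by positivity)]
        have h2 : (ε / C) ^ 2 = ((C ^ 2 * B)⁻¹) ^ 2 * s ^ 2 := by
          rw [hs]
          field_simp
        rw [h2, ENNReal.ofReal_mul (by positivity), mul_comm (ENNReal.ofReal (s ^ 2)), ← mul_assoc,
          ENNReal.div_mul_cancel hpi0 coe_ne_top]
        ring
      rw [h1]
      gcongr
    calc volume (E ∩ closedBall z s) + κ * volume (closedBall z s)
        ≤ volume (closedBall z s ∩ E) + volume (closedBall z s \ E) := by
          rw [inter_comm]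
          gcongr
      _ = volume (closedBall z s) := measure_inter_add_sdiff _ hE
  choose s hs0 hs hle using key
  refine ⟨s, hs0, squeeze_zero (fun n => (hs0 n).le) hs ?_, hle⟩
  have h1 : Tendsto (fun n : ℕ => C * B * ‖z‖ * (1 / 2 : ℝ) ^ n) atTop (𝓝 (C * B * ‖z‖ * 0)) :=
    (_root_.tendsto_pow_atTop_nhds_zero_of_lt_one (by norm_num) (by norm_num)).const_mul _
  rwa [mul_zero] at h1

theorem volume_escapingSet (H : IsLinearizing p lam f) (h : IsEscapeRadius p R)
    (hd : 2 ≤ p.natDegree) (hJ : IsConnected (juliaSet (fun w => p.eval w)))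
    (hK : 0 < volume (filledJuliaSet p)) : volume (escapingSet f) = 0 := by
  obtain ⟨R₁, hE⟩ := H.volume_bounded_below_orbits h hd hJ hK
  set E := {z | ∀ n, R₁ ≤ ‖f^[n] z‖} with hEdef
  have hpre : ∀ N : ℕ, volume ((f^[N]) ⁻¹' E) = 0 := by
    intro N
    induction N with
    | zero => simpa using hE
    | succ N ih =>
      rw [Function.iterate_succ, preimage_comp]
      exact volume_preimage_eq_zero H.differentiable H.deriv_ne_zero ih
  refine measure_mono_null (fun z hz => ?_) (measure_iUnion_null hpre)
  have hz' : Tendsto (fun n => ‖f^[n] z‖) atTop atTop := hz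
  obtain ⟨N, hN⟩ := eventually_atTop.1 (hz'.eventually_ge_atTop R₁)
  refine mem_iUnion.2 ⟨N, fun n => ?_⟩
  rw [← Function.iterate_add_apply]
  exact hN _ (by omega)

end IsLinearizing

theorem poincare_function_escaping_measure_zero
    (p : Polynomial ℂ) (hd : 2 ≤ p.natDegree)
    (hconn : IsConnected (juliaSet (fun w => p.eval w)))
    (z₀ lam : ℂ) (hfix : p.eval z₀ = z₀) (hlam : deriv (fun w => p.eval w) z₀ = lam)
    (hlam1 : 1 < ‖lam‖)
    (f : ℂ → ℂ) (hf : TranscendentalEntire f) (hf0 : f 0 = z₀)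
    (hfe : ∀ z : ℂ, f (lam * z) = p.eval (f z))
    (hK : 0 < volume {z : ℂ |
      ¬ Tendsto (fun n => ‖(fun w => p.eval w)^[n] z‖) atTop atTop}) :
    volume (escapingSet f) = 0 := by
  obtain ⟨R, h⟩ := exists_isEscapeRadius hd
  have H : IsLinearizing p lam f := ⟨hlam1, hf.1, hfe,
    deriv_ne_zero_of_linearizing hlam hlam1 hf.1 hf0 hfe fun hc =>
      hf.2 ⟨Polynomial.C z₀, fun z => by rw [hc z, Polynomial.eval_C]⟩⟩
  exact H.volume_escapingSet h hd hconn hK
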